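/- If a graph G of order at least 6 satisfies (|V(G)|+1)/3 ≤ Δ(G) < |V(G)|/2 and no connected component of G is a complete graph on Δ(G)+1 vertices, then G is equitably Δ(G)-colorable. -/

import Mathlib

open Finset

variable {V : Type*}

/-- `P` is the set of color classes of an `[r,s,t]`-coloring of `G`:
a partition of the vertices into independent sets, with `r` classes of size 3,
`s` classes of size 2 and `t` singleton classes. -/
def IsRST [Fintype V] [DecidableEq V] (G : SimpleGraph V) (P : Finset (Finset V))
    (r s t : ℕ) : Prop :=
  (∀ v : V, ∃! A, A ∈ P ∧ v ∈ A) ∧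
  (∀ A ∈ P, ∀ u ∈ A, ∀ w ∈ A, ¬ G.Adj u w) ∧
  (P.filter (fun A => A.card = 3)).card = r ∧
  (P.filter (fun A => A.card = 2)).card = s ∧
  (P.filter (fun A => A.card = 1)).card = t ∧
  (∀ A ∈ P, A.card = 1 ∨ A.card = 2 ∨ A.card = 3)

/-- A maximal `[r,s,t]`-coloring: for any other `[r',s',t']`-coloring,
either `r > r'`, or `r = r'` and `s ≥ s'`. -/
def IsMaxRST [Fintype V] [DecidableEq V] (G : SimpleGraph V) (P : Finset (Finset V))
    (r s t : ℕ) : Prop :=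
  IsRST G P r s t ∧
  ∀ (P' : Finset (Finset V)) (r' s' t' : ℕ), IsRST G P' r' s' t' →
    r' < r ∨ (r' = r ∧ s' ≤ s)

/-- `eB G X Y` is the number of edges with one endpoint in `X` and the other in `Y`. -/
def eB [Fintype V] [DecidableEq V] (G : SimpleGraph V) [DecidableRel G.Adj]
    (X Y : Finset V) : ℕ :=
  ((X ×ˢ Y).filter fun p => G.Adj p.1 p.2).card

/-- `G` is equitably `k`-colorable: a proper `k`-coloring whose color classes
have sizes differing pairwise by at most 1. -/
def EqColorable [Fintype V] (G : SimpleGraph V) (k : ℕ) : Prop :=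
  ∃ C : V → Fin k, (∀ u v, G.Adj u v → C u ≠ C v) ∧
    ∀ i j : Fin k,
      (Finset.univ.filter fun v => C v = i).card ≤
        (Finset.univ.filter fun v => C v = j).card + 1

section EqHelpers

set_option linter.unusedSectionVars false

variable [Fintype V] [DecidableEq V] (G : SimpleGraph V)

/-- family of pairwise disjoint independent triples -/
def TF (F : Finset (Finset V)) : Prop :=
  (∀ T ∈ F, T.card = 3 ∧ ∀ a ∈ T, ∀ b ∈ T, ¬ G.Adj a b) ∧
  ∀ S ∈ F, ∀ T ∈ F, S ≠ T → Disjoint S T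

/-- vertices not covered -/
def WW (F : Finset (Finset V)) : Finset V := univ \ F.biUnion id

/-- involution on `W` with nonadjacent pairs -/
def MM (W : Finset V) (m : V → V) : Prop :=
  ∀ w ∈ W, m w ∈ W ∧ m (m w) = w ∧ ¬ G.Adj w (m w)

/-- fixed points -/
def fx (W : Finset V) (m : V → V) : Finset V := W.filter fun w => m w = w

/-- number of neighbors in `S` -/
def eT [DecidableRel G.Adj] (w : V) (S : Finset V) : ℕ := (S.filter (G.Adj w)).card

lemma eT_le [DecidableRel G.Adj] (w : V) (S : Finset V) : eT G w S ≤ S.card :=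
  Finset.card_filter_le _ _

lemma mem_WW {F : Finset (Finset V)} {w : V} : w ∈ WW F ↔ ∀ T ∈ F, w ∉ T := by
  simp [WW]

variable {G}

lemma tf_insert {F : Finset (Finset V)} (hF : TF G F) {T : Finset V} (hT : T.card = 3)
    (hi : ∀ a ∈ T, ∀ b ∈ T, ¬ G.Adj a b) (hs : T ⊆ WW F) :
    TF G (insert T F) ∧ (insert T F).card = F.card + 1 ∧ WW (insert T F) = WW F \ T := by
  have hd : ∀ S ∈ F, Disjoint S T := by
    intro S hS
    rw [Finset.disjoint_left]
    intro a ha hb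
    exact (mem_WW.1 (hs hb)) S hS ha
  have hn : T ∉ F := by
    intro h
    have := hd T h
    rw [disjoint_self_iff_empty] at this
    simp [this] at hT
  refine ⟨⟨?_, ?_⟩, card_insert_of_notMem hn, ?_⟩
  · intro S hS
    rcases mem_insert.1 hS with rfl | hS
    · exact ⟨hT, hi⟩
    · exact hF.1 S hS
  · intro S hS S' hS' hne
    rcases mem_insert.1 hS with h1 | h1 <;> rcases mem_insert.1 hS' with h2 | h2
    · exact absurd (h1.trans h2.symm) hne
    · rw [h1]; exact (hd _ h2).symm
    · rw [h2]; exact hd _ h1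
    · exact hF.2 _ h1 _ h2 hne
  · ext w
    simp only [mem_WW, mem_sdiff, mem_insert, forall_eq_or_imp]
    tauto

lemma tf_erase {F : Finset (Finset V)} (hF : TF G F) {T : Finset V} (hT : T ∈ F) :
    TF G (F.erase T) ∧ (F.erase T).card + 1 = F.card ∧ WW (F.erase T) = WW F ∪ T := by
  refine ⟨⟨fun S hS => hF.1 S (mem_of_mem_erase hS), fun S hS S' hS' =>
    hF.2 S (mem_of_mem_erase hS) S' (mem_of_mem_erase hS')⟩, card_erase_add_one hT, ?_⟩
  ext w
  simp only [mem_WW, mem_union, mem_erase]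
  constructor
  · intro h
    by_cases hw : w ∈ T
    · exact Or.inr hw
    · left
      intro S hS
      by_cases e : S = T
      · rwa [e]
      · exact h S ⟨e, hS⟩
  · rintro (h | h) S ⟨h1, h2⟩
    · exact h S h2
    · intro h3
      exact (Finset.disjoint_left.1 (hF.2 S h2 T hT h1)) h3 h

/-- replace a triple -/
lemma tf_swap {F : Finset (Finset V)} (hF : TF G F) {T T' : Finset V} (hT : T ∈ F)
    (h3 : T'.card = 3)
    (hi : ∀ a ∈ T', ∀ b ∈ T', ¬ G.Adj a b) (hs : T' ⊆ WW F ∪ T) :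
    TF G (insert T' (F.erase T)) ∧ (insert T' (F.erase T)).card = F.card ∧
     WW (insert T' (F.erase T)) = (WW F ∪ T) \ T' := by
  obtain ⟨a1, a2, a3⟩ := tf_erase hF hT
  rw [← a3] at hs
  obtain ⟨b1, b2, b3⟩ := tf_insert a1 h3 hi hs
  refine ⟨b1, by omega, by rw [b3, a3]⟩

lemma indep3 {a b c : V} (h1 : ¬ G.Adj a b) (h2 : ¬ G.Adj a c) (h3 : ¬ G.Adj b c) :
    ∀ x ∈ ({a, b, c} : Finset V), ∀ y ∈ ({a, b, c} : Finset V), ¬ G.Adj x y := by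
  intro x hx y hy
  simp only [mem_insert, mem_singleton] at hx hy
  have h1' : ¬ G.Adj b a := fun h => h1 h.symm
  have h2' : ¬ G.Adj c a := fun h => h2 h.symm
  have h3' : ¬ G.Adj c b := fun h => h3 h.symm
  rcases hx with rfl | rfl | rfl <;> rcases hy with rfl | rfl | rfl <;>
    first | assumption | exact G.irrefl

/-- no independent triple in W -/
lemma I0 {F : Finset (Finset V)} (hF : TF G F) (hno : ∀ F', TF G F' → F'.card ≠ F.card + 1)
    {x y z : V} (hx : x ∈ WW F) (hy : y ∈ WW F) (hz : z ∈ WW F) (hxy : x ≠ y) (hxz : x ≠ z)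
    (hyz : y ≠ z) (a1 : ¬ G.Adj x y) (a2 : ¬ G.Adj x z) : G.Adj y z := by
  by_contra a3
  obtain ⟨b1, b2, -⟩ := tf_insert hF (T := {x, y, z}) (by rw [card_eq_three]; exact ⟨x, y, z, hxy, hxz, hyz, rfl⟩)
    (indep3 a1 a2 a3) (by intro t; simp; rintro (rfl | rfl | rfl) <;> assumption)
  exact hno _ b1 b2

lemma I12 {F : Finset (Finset V)} (hF : TF G F) (hno : ∀ F', TF G F' → F'.card ≠ F.card + 1)
    {T T1 T2 : Finset V} (hT : T ∈ F) (c1 : T1.card = 3) (c2 : T2.card = 3)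
    (i1 : ∀ a ∈ T1, ∀ b ∈ T1, ¬ G.Adj a b) (i2 : ∀ a ∈ T2, ∀ b ∈ T2, ¬ G.Adj a b)
    (hd : Disjoint T1 T2) (s1 : T1 ⊆ WW F ∪ T) (s2 : T2 ⊆ WW F ∪ T) : False := by
  obtain ⟨a1, a2, a3⟩ := tf_swap hF hT c1 i1 s1
  obtain ⟨b1, b2, b3⟩ := tf_insert a1 c2 i2 (by
    rw [a3]; intro x hx; rw [mem_sdiff]; exact ⟨s2 hx, fun h => Finset.disjoint_left.1 hd h hx⟩)
  exact hno _ b1 (by omega)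

lemma not_mem_W {F : Finset (Finset V)} {T : Finset V} (hT : T ∈ F) {w a : V} (hw : w ∈ WW F)
    (ha : a ∈ T) : w ≠ a := by
  rintro rfl; exact mem_WW.1 hw T hT ha

lemma vT_props {F : Finset (Finset V)} (hF : TF G F) {T : Finset V} (hT : T ∈ F)
    {v a : V} (hv : v ∈ WW F) (ha : a ∈ T) (hva : ∀ t ∈ T, t ≠ a → ¬ G.Adj v t) :
    (insert v (T.erase a)).card = 3 ∧
    (∀ x ∈ insert v (T.erase a), ∀ y ∈ insert v (T.erase a), ¬ G.Adj x y) ∧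
    insert v (T.erase a) ⊆ WW F ∪ T := by
  have hvT : v ∉ T := mem_WW.1 hv T hT
  obtain ⟨c3, ind⟩ := hF.1 T hT
  refine ⟨?_, ?_, ?_⟩
  · rw [card_insert_of_notMem (fun h => hvT (mem_of_mem_erase h)), card_erase_of_mem ha, c3]
  · intro x hx y hy
    rw [mem_insert, mem_erase] at hx hy
    rcases hx with rfl | hx <;> rcases hy with rfl | hy
    · exact G.irrefl
    · exact hva y hy.2 hy.1
    · exact fun h => hva x hx.2 hx.1 h.symm
    · exact ind x hx.2 y hy.2
  · intro x hx
    rw [mem_insert, mem_erase] at hx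
    rw [mem_union]
    rcases hx with rfl | hx
    · exact Or.inl hv
    · exact Or.inr hx.2

lemma I1 {F : Finset (Finset V)} (hF : TF G F) (hno : ∀ F', TF G F' → F'.card ≠ F.card + 1)
    {T : Finset V} (hT : T ∈ F) {v x y a : V} (hv : v ∈ WW F) (hx : x ∈ WW F) (hy : y ∈ WW F)
    (hvx : v ≠ x) (hvy : v ≠ y) (hxy : x ≠ y) (axy : ¬ G.Adj x y) (ha : a ∈ T)
    (axa : ¬ G.Adj x a) (aya : ¬ G.Adj y a) (hva : ∀ t ∈ T, t ≠ a → ¬ G.Adj v t) : False := by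
  obtain ⟨p1, p2, p3⟩ := vT_props hF hT hv ha hva
  have hxa := not_mem_W hT hx ha
  have hya := not_mem_W hT hy ha
  have hva' := not_mem_W hT hv ha
  refine I12 hF hno hT (T1 := insert v (T.erase a)) (T2 := {x, y, a}) p1
    (by rw [card_eq_three]; exact ⟨x, y, a, hxy, hxa, hya, rfl⟩) p2 (indep3 axy axa aya) ?_ p3 ?_
  · rw [Finset.disjoint_left]
    intro t h1 h2
    simp only [mem_insert, mem_erase, mem_singleton] at h1 h2
    have := mem_WW.1 hx T hT
    have := mem_WW.1 hy T hT
    grind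
  · intro t h
    simp only [mem_insert, mem_singleton] at h
    rw [mem_union]
    rcases h with rfl | rfl | rfl <;> tauto

lemma I2 {F : Finset (Finset V)} (hF : TF G F) (hno : ∀ F', TF G F' → F'.card ≠ F.card + 1)
    {T : Finset V} (hT : T ∈ F) {x y z w a b : V} (hx : x ∈ WW F) (hy : y ∈ WW F)
    (hz : z ∈ WW F) (hw : w ∈ WW F) (hxy : x ≠ y) (hzw : z ≠ w) (hxz : x ≠ z) (hxw : x ≠ w)
    (hyz : y ≠ z) (hyw : y ≠ w) (axy : ¬ G.Adj x y) (azw : ¬ G.Adj z w)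
    (ha : a ∈ T) (hb : b ∈ T) (hab : a ≠ b)
    (axa : ¬ G.Adj x a) (aya : ¬ G.Adj y a) (azb : ¬ G.Adj z b) (awb : ¬ G.Adj w b) : False := by
  have hxa := not_mem_W hT hx ha
  have hya := not_mem_W hT hy ha
  have hzb := not_mem_W hT hz hb
  have hwb := not_mem_W hT hw hb
  have hxb := not_mem_W hT hx hb
  have hyb := not_mem_W hT hy hb
  have hza := not_mem_W hT hz ha
  have hwa := not_mem_W hT hw ha
  refine I12 hF hno hT (T1 := {x, y, a}) (T2 := {z, w, b})
    (by rw [card_eq_three]; exact ⟨x, y, a, hxy, hxa, hya, rfl⟩)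
    (by rw [card_eq_three]; exact ⟨z, w, b, hzw, hzb, hwb, rfl⟩)
    (indep3 axy axa aya) (indep3 azw azb awb) ?_ ?_ ?_
  · rw [Finset.disjoint_left]
    intro t h1 h2
    simp only [mem_insert, mem_singleton] at h1 h2
    grind
  · intro t h
    simp only [mem_insert, mem_singleton] at h
    rw [mem_union]
    rcases h with rfl | rfl | rfl <;> tauto
  · intro t h
    simp only [mem_insert, mem_singleton] at h
    rw [mem_union]
    rcases h with rfl | rfl | rfl <;> tauto

/-- exchange a vertex of W with a vertex of a triple -/
lemma swap1 {F : Finset (Finset V)} (hF : TF G F) {T : Finset V} (hT : T ∈ F)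
    {v a : V} (hv : v ∈ WW F) (ha : a ∈ T) (hva : ∀ t ∈ T, t ≠ a → ¬ G.Adj v t) :
    ∃ F', TF G F' ∧ F'.card = F.card ∧ WW F' = insert a ((WW F).erase v) ∧
      ∀ S ∈ F, S ≠ T → S ∈ F' := by
  obtain ⟨p1, p2, p3⟩ := vT_props hF hT hv ha hva
  obtain ⟨q1, q2, q3⟩ := tf_swap hF hT p1 p2 p3
  refine ⟨_, q1, q2, ?_, ?_⟩
  · rw [q3]
    ext t
    simp only [mem_sdiff, mem_union, mem_insert, mem_erase]
    have : t ∈ WW F → t ∉ T := fun h => mem_WW.1 h T hT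
    have hva' := not_mem_W hT hv ha
    have hvT : v ∉ T := mem_WW.1 hv T hT
    grind
  · intro S hS hne
    simp [hS, hne]

variable [DecidableRel G.Adj]

lemma eT_union (w : V) {A B : Finset V} (h : Disjoint A B) :
    eT G w (A ∪ B) = eT G w A + eT G w B := by
  unfold eT
  rw [filter_union, card_union_of_disjoint (disjoint_filter_filter h)]

lemma deg_split {F : Finset (Finset V)} (hF : TF G F) (w : V) :
    eT G w univ = ∑ T ∈ F, eT G w T + eT G w (WW F) := by
  have h1 : eT G w (F.biUnion id) = ∑ T ∈ F, eT G w T := by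
    unfold eT
    rw [filter_biUnion, card_biUnion]
    · rfl
    · intro S hS T hT hne
      exact disjoint_filter_filter (hF.2 S hS T hT hne)
  rw [← h1, WW, ← eT_union w disjoint_sdiff, union_sdiff_of_subset (subset_univ _)]

lemma card_split {F : Finset (Finset V)} (hF : TF G F) :
    Fintype.card V = 3 * F.card + (WW F).card := by
  have h1 : (F.biUnion id).card = 3 * F.card := by
    rw [card_biUnion]
    · have : ∑ u ∈ F, (id u).card = ∑ u ∈ F, 3 := Finset.sum_congr rfl (fun T hT => (hF.1 T hT).1)
      rw [this, sum_const, smul_eq_mul, mul_comm]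
    intro S hS T hT hne
    exact (hF.2 S hS T hT hne)
  rw [← h1, WW, ← card_univ, add_comm, card_sdiff_add_card_eq_card (subset_univ _)]

lemma sum_inv {W : Finset V} {m : V → V} (hm : MM G W m) {v : V} (hv : fx W m = {v}) (f : V → ℕ) :
    ∑ w ∈ W.erase v, (f w + f (m w)) = 2 * ∑ w ∈ W.erase v, f w := by
  have hvm : m v = v ∧ v ∈ W := by
    have : v ∈ fx W m := by simp [hv]
    simp [fx] at this; tauto
  have h : ∑ w ∈ W.erase v, f (m w) = ∑ w ∈ W.erase v, f w := by
    have key : ∀ w ∈ W.erase v, m w ∈ W.erase v := by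
      intro w hw
      rw [mem_erase] at hw ⊢
      refine ⟨fun e => hw.1 ?_, (hm w hw.2).1⟩
      rw [← (hm w hw.2).2.1, e, hvm.1]
    refine Finset.sum_bij' (fun w _ => m w) (fun w _ => m w) key key ?_ ?_ ?_
    · intro w hw; exact (hm w (mem_of_mem_erase hw)).2.1
    · intro w hw; exact (hm w (mem_of_mem_erase hw)).2.1
    · intro w hw; rfl
  rw [sum_add_distrib, h]; ring

lemma fx_facts {W : Finset V} {m : V → V} (hm : MM G W m) {v : V} (hv : fx W m = {v}) :
    v ∈ W ∧ m v = v ∧ ∀ w ∈ W, w ≠ v → m w ∈ W ∧ m w ≠ w ∧ m w ≠ v := by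
  have hvm : v ∈ W ∧ m v = v := by
    have : v ∈ fx W m := by simp [hv]
    simpa [fx] using this
  refine ⟨hvm.1, hvm.2, fun w hw hne => ⟨(hm w hw).1, ?_, ?_⟩⟩
  · intro e
    have : w ∈ fx W m := by simp [fx, hw, e]
    rw [hv, mem_singleton] at this
    exact hne this
  · intro e
    apply hne
    rw [← (hm w hw).2.1, e, hvm.2]

lemma free_card (T : Finset V) (x y : V) :
    T.card ≤ eT G x T + eT G y T + (T.filter fun t => ¬ G.Adj x t ∧ ¬ G.Adj y t).card := by
  unfold eT
  have : T ⊆ T.filter (G.Adj x) ∪ T.filter (G.Adj y) ∪ (T.filter fun t => ¬ G.Adj x t ∧ ¬ G.Adj y t) := by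
    intro t ht
    simp only [mem_union, mem_filter]
    tauto
  refine (card_le_card this).trans ((card_union_le _ _).trans ?_)
  gcongr
  exact card_union_le _ _

lemma free1 {T : Finset V} (hT : T.card = 3) {x y : V} (h : eT G x T + eT G y T < 3) :
    ∃ f ∈ T, ¬ G.Adj x f ∧ ¬ G.Adj y f := by
  have := free_card (G := G) T x y
  have h2 : 0 < (T.filter fun t => ¬ G.Adj x t ∧ ¬ G.Adj y t).card := by omega
  obtain ⟨f, hf⟩ := card_pos.1 h2
  rw [mem_filter] at hf
  exact ⟨f, hf⟩

lemma free2 {T : Finset V} (hT : T.card = 3) {x y : V} (h : eT G x T + eT G y T < 2) :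
    ∃ f ∈ T, ∃ f' ∈ T, f ≠ f' ∧ (¬ G.Adj x f ∧ ¬ G.Adj y f) ∧ (¬ G.Adj x f' ∧ ¬ G.Adj y f') := by
  have := free_card (G := G) T x y
  have h2 : 1 < (T.filter fun t => ¬ G.Adj x t ∧ ¬ G.Adj y t).card := by omega
  obtain ⟨f, hf, f', hf', hne⟩ := one_lt_card.1 h2
  rw [mem_filter] at hf hf'
  exact ⟨f, hf.1, f', hf'.1, hne, hf.2, hf'.2⟩

lemma eT_zero {T : Finset V} {v : V} : eT G v T = 0 ↔ ∀ t ∈ T, ¬ G.Adj v t := by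
  simp [eT, filter_eq_empty_iff]

lemma eT_one {T : Finset V} {v : V} (h : eT G v T = 1) : ∃ a ∈ T, ∀ t ∈ T, G.Adj v t ↔ t = a := by
  obtain ⟨a, ha⟩ := card_eq_one.1 h
  have : ∀ t, (t ∈ T ∧ G.Adj v t) ↔ t = a := by
    intro t; rw [← mem_filter, ha, mem_singleton]
  exact ⟨a, ((this a).2 rfl).1, fun t ht => by rw [← this t]; tauto⟩

lemma eT_full {T : Finset V} {v : V} (h : ∀ t ∈ T, G.Adj v t) : eT G v T = T.card := by
  rw [eT, filter_true_of_mem h]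

lemma ineqT {F : Finset (Finset V)} (hF : TF G F) (hno : ∀ F', TF G F' → F'.card ≠ F.card + 1)
    {N : ℕ} (hN : 2 ≤ N) (hW : (WW F).card = 2 * N + 1) {m : V → V} (hm : MM G (WW F) m) {v : V}
    (hv : fx (WW F) m = {v}) {T : Finset V} (hT : T ∈ F) :
    3 * N ≤ N * eT G v T + ∑ w ∈ (WW F).erase v, eT G w T := by
  obtain ⟨hvW, hvm, hfx⟩ := fx_facts hm hv
  have h3 := (hF.1 T hT).1
  set W := WW F with hWdef
  set g : V → ℕ := fun w => eT G w T + eT G (m w) T with hg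
  have hsum : ∑ w ∈ W.erase v, g w = 2 * ∑ w ∈ W.erase v, eT G w T :=
    sum_inv hm hv (fun w => eT G w T)
  have hc : (W.erase v).card = 2 * N := by rw [card_erase_of_mem hvW, hW]; rfl
  have z3 : eT G v T = 0 → ∀ w ∈ W.erase v, 3 ≤ g w := by
    intro h0 w hw
    rw [mem_erase] at hw
    obtain ⟨q1, q2, q3⟩ := hfx w hw.2 hw.1
    by_contra hlt
    obtain ⟨f, hf, f1, f2⟩ := free1 h3 (not_le.1 hlt)
    exact I1 hF hno hT hvW hw.2 q1 hw.1.symm q3.symm q2.symm (hm w hw.2).2.2 hf f1 f2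
      (fun t ht _ => eT_zero.1 h0 t ht)
  have card3 : ∀ c, (∀ w ∈ W.erase v, c ≤ g w) → 2 * N * c ≤ ∑ w ∈ W.erase v, g w := by
    intro c h
    rw [← hc, ← smul_eq_mul]
    exact card_nsmul_le_sum _ _ _ h
  by_cases h0 : eT G v T = 0
  · have := card3 3 (z3 h0)
    rw [h0]; omega
  by_cases hex : ∃ w0 ∈ W.erase v, g w0 < 2
  · obtain ⟨w0, hw0, hlt⟩ := hex
    have hw0' := mem_erase.1 hw0
    obtain ⟨q1, q2, q3⟩ := hfx w0 hw0'.2 hw0'.1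
    obtain ⟨f, hf, f', hf', hne, ⟨e1, e2⟩, ⟨e3, e4⟩⟩ := free2 h3 hlt
    have hoth : ∀ w ∈ ((W.erase v).erase w0).erase (m w0), 3 ≤ g w := by
      intro w hw
      simp only [mem_erase] at hw
      obtain ⟨k1, k2, k3, k4⟩ := hw
      obtain ⟨r1, r2, r3⟩ := hfx w k4 k3
      have n1 : m w ≠ w0 := fun e => k1 (by rw [← e, (hm w k4).2.1])
      have n2 : m w ≠ m w0 := fun e => k2 (by rw [← (hm w k4).2.1, e, (hm w0 hw0'.2).2.1])
      by_contra hl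
      obtain ⟨c, hc, c1, c2⟩ := free1 h3 (not_le.1 hl)
      by_cases hcf : c = f
      · exact I2 hF hno hT hw0'.2 q1 k4 r1 q2.symm r2.symm k2.symm n1.symm k1.symm n2.symm
          (hm w0 hw0'.2).2.2 (hm w k4).2.2 hf' hc (by rw [hcf]; exact hne.symm) e3 e4 c1 c2
      · exact I2 hF hno hT hw0'.2 q1 k4 r1 q2.symm r2.symm k2.symm n1.symm k1.symm n2.symm
          (hm w0 hw0'.2).2.2 (hm w k4).2.2 hf hc (Ne.symm hcf) e1 e2 c1 c2
    have hmm : m w0 ∈ (W.erase v).erase w0 := by simp [q1, q2, q3]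
    have hcc : (((W.erase v).erase w0).erase (m w0)).card = 2 * N - 2 := by
      rw [card_erase_of_mem hmm, card_erase_of_mem hw0, hc]; rfl
    have hs1 : (2 * N - 2) * 3 ≤ ∑ w ∈ ((W.erase v).erase w0).erase (m w0), g w := by
      rw [← hcc, ← smul_eq_mul]
      exact card_nsmul_le_sum _ _ _ hoth
    have hs2 : ∑ w ∈ W.erase v, g w = g w0 + (g (m w0) + ∑ w ∈ ((W.erase v).erase w0).erase (m w0), g w) := by
      rw [add_sum_erase _ _ hmm, add_sum_erase _ _ hw0]
    have hgg : g (m w0) = g w0 := by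
      simp only [hg]; rw [(hm w0 hw0'.2).2.1, add_comm]
    by_cases h1 : eT G v T = 1
    · have hg1 : 1 ≤ g w0 := by
        by_contra hl
        have hl' : eT G w0 T + eT G (m w0) T = 0 := by
          have : g w0 = eT G w0 T + eT G (m w0) T := rfl
          omega
        obtain ⟨a, ha, hat⟩ := eT_one h1
        exact I1 hF hno hT hvW hw0'.2 q1 hw0'.1.symm q3.symm q2.symm (hm w0 hw0'.2).2.2 ha
          (eT_zero.1 (by omega) a ha) (eT_zero.1 (by omega) a ha)
          (fun t ht hta h => hta ((hat t ht).1 h))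
      rw [h1]; omega
    · have : N * 2 ≤ N * eT G v T := Nat.mul_le_mul_left _ (by omega)
      omega
  · push Not at hex
    have := card3 2 hex
    have : N * 1 ≤ N * eT G v T := Nat.mul_le_mul_left _ (by omega)
    omega

lemma eT_sum (v : V) (S : Finset V) : eT G v S = ∑ w ∈ S, if G.Adj v w then 1 else 0 := by
  rw [eT, card_filter]

lemma lemJ {F : Finset (Finset V)} (hF : TF G F) (hno : ∀ F', TF G F' → F'.card ≠ F.card + 1)
    {N : ℕ} (hN : 2 ≤ N) (hW : (WW F).card = 2 * N + 1)
    (hdeg : ∀ w, eT G w univ ≤ F.card + N) {m : V → V} (hm : MM G (WW F) m) {v : V}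
    (hv : fx (WW F) m = {v}) :
    ∀ w ∈ WW F, w ≠ v → (G.Adj v w ↔ ¬ G.Adj v (m w)) := by
  obtain ⟨hvW, hvm, hfx⟩ := fx_facts hm hv
  have hor : ∀ w ∈ WW F, w ≠ v → (G.Adj v w ∨ G.Adj v (m w)) := by
    intro w hw hne
    obtain ⟨q1, q2, q3⟩ := hfx w hw hne
    by_contra hcon
    push Not at hcon
    exact (hm w hw).2.2 (I0 hF hno hvW hw q1 hne.symm q3.symm q2.symm hcon.1 hcon.2)
  have hnb : ∀ w ∈ WW F, w ≠ v → ¬ (G.Adj v w ∧ G.Adj v (m w)) := by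
    intro w0 hw0 hne0 hboth
    obtain ⟨q1, q2, q3⟩ := hfx w0 hw0 hne0
    have hc : ((WW F).erase v).card = 2 * N := by rw [card_erase_of_mem hvW, hW]; rfl
    -- sum over triples
    have hTsum : 3 * N * F.card ≤ N * ∑ T ∈ F, eT G v T + ∑ w ∈ (WW F).erase v, ∑ T ∈ F, eT G w T := by
      rw [sum_comm, mul_sum, ← sum_add_distrib, mul_comm, ← smul_eq_mul]
      exact card_nsmul_le_sum _ _ _ (fun T hT => ineqT hF hno hN hW hm hv hT)
    have hd1 : ∑ w ∈ (WW F).erase v, eT G w univ ≤ 2 * N * (F.card + N) := by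
      rw [← hc, ← smul_eq_mul]
      exact sum_le_card_nsmul _ _ _ (fun w _ => hdeg w)
    have hd2 := Nat.mul_le_mul_left N (hdeg v)
    simp only [deg_split hF] at hd1 hd2
    rw [sum_add_distrib] at hd1
    -- inner bounds
    have hmem0 : w0 ∈ (WW F).erase v := mem_erase.2 ⟨hne0, hw0⟩
    have hmem1 : m w0 ∈ ((WW F).erase v).erase w0 := by simp [q1, q2, q3]
    have split : ∀ g : V → ℕ, ∀ c, (∀ w ∈ (WW F).erase v, c ≤ g w) → c + 1 ≤ g w0 → c + 1 ≤ g (m w0) →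
        2 * N * c + 2 ≤ ∑ w ∈ (WW F).erase v, g w := by
      intro g c h1 h2 h3
      have hs2 : ∑ w ∈ (WW F).erase v, g w
          = g w0 + (g (m w0) + ∑ w ∈ (((WW F).erase v).erase w0).erase (m w0), g w) := by
        rw [add_sum_erase _ _ hmem1, add_sum_erase _ _ hmem0]
      have hcc : ((((WW F).erase v).erase w0).erase (m w0)).card = 2 * N - 2 := by
        rw [card_erase_of_mem hmem1, card_erase_of_mem hmem0, hc]; rfl
      have hs1 : (2 * N - 2) * c ≤ ∑ w ∈ (((WW F).erase v).erase w0).erase (m w0), g w := by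
        rw [← hcc, ← smul_eq_mul]
        exact card_nsmul_le_sum _ _ _ (fun w hw => h1 w (mem_of_mem_erase (mem_of_mem_erase hw)))
      have : (2 * N - 2) * c + 2 * c = 2 * N * c := by
        rw [← add_mul]; congr 1; omega
      omega
    have hA : 2 * N * 1 + 2 ≤ 2 * eT G v (WW F) := by
      have e1 : eT G v (WW F) = ∑ w ∈ (WW F).erase v, if G.Adj v w then 1 else 0 := by
        rw [eT_sum, ← add_sum_erase _ _ hvW]; simp
      rw [e1, ← sum_inv hm hv]
      apply split
      · intro w hw
        rw [mem_erase] at hw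
        rcases hor w hw.2 hw.1 with h | h <;> simp [h]
      · simp [hboth]
      · rw [(hm w0 hw0).2.1]; simp [hboth]
    have hB : 2 * N * (2 * N - 1) + 2 ≤ 2 * ∑ w ∈ (WW F).erase v, eT G w (WW F) := by
      rw [← sum_inv hm hv]
      have base : ∀ w ∈ (WW F).erase v, eT G w (WW F) + eT G (m w) (WW F) =
          ∑ u ∈ ((WW F).erase w).erase (m w), ((if G.Adj w u then 1 else 0) + (if G.Adj (m w) u then 1 else 0)) := by
        intro w hw
        rw [mem_erase] at hw
        obtain ⟨q1, q2, q3⟩ := hfx w hw.2 hw.1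
        have hmw : m w ∈ (WW F).erase w := mem_erase.2 ⟨q2, q1⟩
        have na := (hm w hw.2).2.2
        have nb : ¬ G.Adj (m w) w := fun h => na h.symm
        rw [eT_sum, eT_sum, ← sum_add_distrib, ← add_sum_erase _ _ hw.2, ← add_sum_erase _ _ hmw]
        simp [na, nb]
      have base2 : ∀ w ∈ (WW F).erase v, ∀ u ∈ ((WW F).erase w).erase (m w),
          1 ≤ (if G.Adj w u then 1 else 0) + (if G.Adj (m w) u then 1 else 0) := by
        intro w hw u hu
        simp only [mem_erase] at hw hu
        obtain ⟨q1, q2, q3⟩ := hfx w hw.2 hw.1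
        by_cases h : G.Adj w u
        · simp [h]
        · have := I0 hF hno hw.2 q1 hu.2.2 q2.symm hu.2.1.symm hu.1.symm (hm w hw.2).2.2 h
          simp [this]
      have cc : ∀ w ∈ (WW F).erase v, (((WW F).erase w).erase (m w)).card = 2 * N - 1 := by
        intro w hw
        rw [mem_erase] at hw
        obtain ⟨q1, q2, q3⟩ := hfx w hw.2 hw.1
        rw [card_erase_of_mem (mem_erase.2 ⟨q2, q1⟩), card_erase_of_mem hw.2, hW]; omega
      have spec : 2 * N - 1 + 1 ≤ eT G w0 (WW F) + eT G (m w0) (WW F) := by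
        rw [base w0 hmem0]
        have hvv : v ∈ ((WW F).erase w0).erase (m w0) := by
          simp [hvW, hne0.symm, q3.symm]
        rw [← add_sum_erase _ _ hvv]
        have h1 : ((((WW F).erase w0).erase (m w0)).erase v).card * 1 ≤
            ∑ u ∈ (((WW F).erase w0).erase (m w0)).erase v,
              ((if G.Adj w0 u then 1 else 0) + (if G.Adj (m w0) u then 1 else 0)) := by
          rw [← smul_eq_mul]
          exact card_nsmul_le_sum _ _ _ (fun u hu => base2 w0 hmem0 u (mem_of_mem_erase hu))
        rw [card_erase_of_mem hvv, cc w0 hmem0] at h1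
        have h2 := hboth.1.symm
        have h3 := hboth.2.symm
        simp only [h2, h3, if_true]
        omega
      apply split
      · intro w hw
        rw [base w hw, ← cc w hw]
        have := card_nsmul_le_sum _ _ _ (base2 w hw)
        simpa using this
      · exact spec
      · rw [(hm w0 hw0).2.1, add_comm (eT G (m w0) (WW F))]; exact spec
    have hA' := Nat.mul_le_mul_left N hA
    obtain ⟨M, rfl⟩ : ∃ M, N = M + 2 := ⟨N - 2, by omega⟩
    have : 2 * (M + 2) - 1 = 2 * M + 3 := by omega
    rw [this] at hB
    nlinarith
  intro w hw hne
  have := hor w hw hne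
  have := hnb w hw hne
  tauto

lemma moveP {W : Finset V} {m : V → V} (hm : MM G W m) {v z : V} (hv : v ∈ fx W m) (hz : z ∈ W)
    (hzz : m z ≠ z) (hvz : ¬ G.Adj v (m z)) :
    ∃ m', MM G W m' ∧ fx W m' = insert z ((fx W m).erase v) ∧ m' v = m z ∧ m' (m z) = v ∧
      ∀ w, w ≠ v → w ≠ z → w ≠ m z → m' w = m w := by
  have hv' : v ∈ W ∧ m v = v := by simpa [fx] using hv
  obtain ⟨hvW, hvm⟩ := hv'
  have z1 := (hm z hz).1
  have z2 := (hm z hz).2.1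
  have zv : z ≠ v := by rintro rfl; exact hzz hvm
  have mzv : m z ≠ v := by intro e; rw [e, hvm] at z2; exact zv z2.symm
  refine ⟨fun w => if w = z then z else if w = v then m z else if w = m z then v else m w,
    ?_, ?_, ?_, ?_, ?_⟩
  · intro w hw
    obtain ⟨a1, a2, a3⟩ := hm w hw
    by_cases e1 : w = z
    · subst e1; simp [hz]
    by_cases e2 : w = v
    · subst e2; simp [zv.symm, z1, hzz, mzv, hvz]
    by_cases e3 : w = m z
    · subst e3
      simp [hzz, mzv, hvW, zv.symm]
      exact fun h => hvz h.symm
    have b1 : m w ≠ z := by intro e; apply e3; rw [← a2, e]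
    have b2 : m w ≠ v := by intro e; apply e2; rw [← a2, e, hvm]
    have b3 : m w ≠ m z := by intro e; apply e1; rw [← a2, e, z2]
    simp [e1, e2, e3, b1, b2, b3, a1, a2, a3]
  · ext w
    simp only [fx, mem_filter, mem_insert, mem_erase]
    by_cases e1 : w = z
    · subst e1; simp [hz]
    by_cases e2 : w = v
    · subst e2; simp [zv.symm, mzv]
    by_cases e3 : w = m z
    · subst e3
      simp [hzz, mzv, mzv.symm, z2, hzz.symm]
    simp [e1, e2, e3]
  · simp [zv.symm]
  · simp [hzz, mzv]
  · intro w h1 h2 h3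
    simp [h1, h2, h3]

lemma moveT {W : Finset V} {m : V → V} (hm : MM G W m) {v a : V} (hv : v ∈ fx W m) (ha : a ∉ W) :
    ∃ m', MM G (insert a (W.erase v)) m' ∧ fx (insert a (W.erase v)) m' = insert a ((fx W m).erase v) ∧
      ∀ w, w ≠ a → m' w = m w := by
  have hv' : v ∈ W ∧ m v = v := by simpa [fx] using hv
  obtain ⟨hvW, hvm⟩ := hv'
  refine ⟨fun w => if w = a then a else m w, ?_, ?_, ?_⟩
  · intro w hw
    by_cases e : w = a
    · subst e; simp
    rw [mem_insert, mem_erase] at hw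
    have hw' : w ≠ v ∧ w ∈ W := by tauto
    obtain ⟨a1, a2, a3⟩ := hm w hw'.2
    have b1 : m w ≠ a := by rintro h; exact ha (h ▸ a1)
    have b2 : m w ≠ v := by intro h; apply hw'.1; rw [← a2, h, hvm]
    simp [e, b1, b2, a1, a2, a3]
  · ext w
    simp only [fx, mem_filter, mem_insert, mem_erase]
    by_cases e : w = a
    · subst e; simp
    simp [e]; tauto
  · intro w h; simp [h]

lemma addPair {W : Finset V} {m : V → V} (hm : MM G W m) {p q : V} (hp : p ∉ W) (hq : q ∉ W)
    (hpq : p ≠ q) (apq : ¬ G.Adj p q) :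
    ∃ m', MM G (insert p (insert q W)) m' ∧ fx (insert p (insert q W)) m' = fx W m := by
  refine ⟨fun w => if w = p then q else if w = q then p else m w, ?_, ?_⟩
  · intro w hw
    by_cases e : w = p
    · subst e; simp [hpq.symm, apq]
    by_cases e' : w = q
    · subst e'; simp [e]; exact fun h => apq h.symm
    have hw : w ∈ W := by simpa [e, e'] using hw
    obtain ⟨a1, a2, a3⟩ := hm w hw
    have b1 : m w ≠ p := by rintro h; exact hp (h ▸ a1)
    have b2 : m w ≠ q := by rintro h; exact hq (h ▸ a1)
    simp [e, e', b1, b2, a1, a2, a3]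
  · ext w
    simp only [fx, mem_filter, mem_insert]
    by_cases e : w = p
    · subst e; simp [hpq.symm, hp]
    by_cases e' : w = q
    · subst e'; simp [e, hq, hpq]
    simp [e, e']

lemma addSingle {W : Finset V} {m : V → V} (hm : MM G W m) {p : V} (hp : p ∉ W) :
    ∃ m', MM G (insert p W) m' ∧ fx (insert p W) m' = insert p (fx W m) := by
  refine ⟨fun w => if w = p then p else m w, ?_, ?_⟩
  · intro w hw
    by_cases e : w = p
    · subst e; simp
    have hw : w ∈ W := by simpa [e] using hw
    obtain ⟨a1, a2, a3⟩ := hm w hw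
    have b1 : m w ≠ p := by rintro h; exact hp (h ▸ a1)
    simp [e, b1, a1, a2, a3]
  · ext w
    simp only [fx, mem_filter, mem_insert]
    by_cases e : w = p
    · subst e; simp
    simp [e]

lemma MM_empty : MM G (∅ : Finset V) id ∧ fx (∅ : Finset V) id = ∅ := by
  constructor
  · intro w hw; simp at hw
  · simp [fx]

/-- matching between two equal size sets -/
lemma MM_bip (n : ℕ) : ∀ X Y : Finset V, X.card = n → Y.card = n → Disjoint X Y →
    (∀ x ∈ X, ∀ y ∈ Y, ¬ G.Adj x y) → ∃ m, MM G (X ∪ Y) m ∧ fx (X ∪ Y) m = ∅ := by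
  induction n with
  | zero =>
    intro X Y hX hY _ _
    rw [card_eq_zero] at hX hY
    subst hX hY
    exact ⟨id, by simpa using MM_empty⟩
  | succ n ih =>
    intro X Y hX hY hd hn
    obtain ⟨x, hx⟩ := card_pos.1 (by omega : 0 < X.card)
    obtain ⟨y, hy⟩ := card_pos.1 (by omega : 0 < Y.card)
    rw [Finset.disjoint_left] at hd
    obtain ⟨m, h1, h2⟩ := ih (X.erase x) (Y.erase y) (by rw [card_erase_of_mem hx]; omega)
      (by rw [card_erase_of_mem hy]; omega)
      (by rw [Finset.disjoint_left]; intro a ha hb; exact hd (mem_of_mem_erase ha) (mem_of_mem_erase hb))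
      (fun a ha b hb => hn a (mem_of_mem_erase ha) b (mem_of_mem_erase hb))
    obtain ⟨m', h3, h4⟩ := addPair h1 (p := x) (q := y)
      (by simp; intro _; exact hd hx) (by simp; exact fun _ h => hd h hy)
      (by rintro rfl; exact hd hx hy) (hn x hx y hy)
    have : insert x (insert y (X.erase x ∪ Y.erase y)) = X ∪ Y := by
      ext w; simp only [mem_insert, mem_union, mem_erase]; grind
    rw [this] at h3 h4
    exact ⟨m', h3, by rw [h4, h2]⟩

lemma c5step {F : Finset (Finset V)} (hF : TF G F) (hno : ∀ F', TF G F' → F'.card ≠ F.card + 1)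
    {T : Finset V} (hT : T ∈ F) {w0 w1 w2 w3 w4 f0 f1 f2 f3 f4 : V}
    (hw0 : w0 ∈ WW F) (hw1 : w1 ∈ WW F) (hw2 : w2 ∈ WW F) (hw3 : w3 ∈ WW F) (hw4 : w4 ∈ WW F)
    (hnd : [w0, w1, w2, w3, w4].Nodup) (h12 : ¬ G.Adj w1 w2) (h34 : ¬ G.Adj w3 w4)
    (m0 : f0 ∈ T) 
    (a0 : ∀ t ∈ T, G.Adj w0 t ↔ t = f0) (a1 : ∀ t ∈ T, G.Adj w1 t ↔ t = f1)
    (a2 : ∀ t ∈ T, G.Adj w2 t ↔ t = f2) (a3 : ∀ t ∈ T, G.Adj w3 t ↔ t = f3)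
    (a4 : ∀ t ∈ T, G.Adj w4 t ↔ t = f4) : f1 ≠ f2 ∧ (f0 = f1 ∨ f0 = f2) := by
  have h3 := (hF.1 T hT).1
  simp only [List.nodup_cons, List.mem_cons, List.not_mem_nil, or_false, not_or] at hnd
  obtain ⟨⟨n1, n2, n3, n4⟩, ⟨n5, n6, n7⟩, ⟨n8, n9⟩, n10, -⟩ := hnd
  have pick : ∀ p q : V, ∃ g ∈ T, g ≠ p ∧ g ≠ q := by
    intro p q
    have : 0 < (T \ {p, q}).card := by
      have := le_card_sdiff {p, q} T
      have := card_le_two (a := p) (b := q)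
      omega
    obtain ⟨g, hg⟩ := card_pos.1 this
    simp at hg
    exact ⟨g, hg⟩
  constructor
  · intro e
    obtain ⟨g, hg, g1, g2⟩ := pick f3 f4
    obtain ⟨h, hh, k1, k2⟩ := pick f1 g
    refine I2 hF hno hT hw1 hw2 hw3 hw4 n5 n10 n6 n7 n8 n9 h12 h34 hh hg k2 ?_ ?_ ?_ ?_
    · rw [a1 h hh]; exact k1
    · rw [a2 h hh, ← e]; exact k1
    · rw [a3 g hg]; exact g1
    · rw [a4 g hg]; exact g2
  · by_contra hcon
    push Not at hcon
    refine I1 hF hno hT hw0 hw1 hw2 n1 n2 n5 h12 m0 ?_ ?_ ?_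
    · rw [a1 _ m0]; exact hcon.1
    · rw [a2 _ m0]; exact hcon.2
    · intro t ht hne; rw [a0 t ht]; exact hne

lemma c5ineq {F : Finset (Finset V)} (hF : TF G F) (hno : ∀ F', TF G F' → F'.card ≠ F.card + 1)
    {w0 w1 w2 w3 w4 : V}
    (hW : WW F = {w0, w1, w2, w3, w4})
    (hdeg : ∀ w, eT G w univ ≤ F.card + 2)
    (hnd : [w0, w1, w2, w3, w4].Nodup) (h01 : ¬ G.Adj w0 w1) (h12 : ¬ G.Adj w1 w2)
    (h34 : ¬ G.Adj w3 w4) (h40 : ¬ G.Adj w4 w0) :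
    (∀ T ∈ F, 6 ≤ 2 * eT G w0 T + (eT G w1 T + eT G w2 T + eT G w3 T + eT G w4 T)) ∧
    ∑ T ∈ F, eT G w0 T ≤ F.card := by
  simp only [List.nodup_cons, List.mem_cons, List.not_mem_nil, or_false, not_or] at hnd
  obtain ⟨⟨n1, n2, n3, n4⟩, ⟨n5, n6, n7⟩, ⟨n8, n9⟩, n10, -⟩ := hnd
  have hcard : (WW F).card = 2 * 2 + 1 := by
    rw [hW]
    simp [*]
  constructor
  · intro T hT
    obtain ⟨m, k1, k2⟩ : ∃ m, MM G (WW F) m ∧ fx (WW F) m = {w0} := by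
      obtain ⟨ma, b1, b2⟩ := addSingle (MM_empty (G := G)).1 (p := w0) (by simp)
      obtain ⟨mb, c1, c2⟩ := addPair b1 (p := w3) (q := w4) (by simp; tauto) (by simp; tauto) n10 h34
      obtain ⟨mc, d1, d2⟩ := addPair c1 (p := w1) (q := w2) (by simp; tauto) (by simp; tauto) n5 h12
      have : insert w1 (insert w2 (insert w3 (insert w4 (insert w0 (∅ : Finset V))))) = WW F := by
        rw [hW]; ext t; simp; tauto
      rw [this] at d1 d2
      exact ⟨mc, d1, by rw [d2, c2, b2, MM_empty (G := G).2]; rfl⟩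
    have := ineqT hF hno (le_refl 2) hcard k1 k2 hT
    have e : (WW F).erase w0 = {w1, w2, w3, w4} := by
      rw [hW]; ext t; simp; grind
    rw [e] at this
    rw [sum_insert (by simp; tauto), sum_insert (by simp; tauto), sum_insert (by simp; tauto),
      sum_singleton] at this
    omega
  · have h1 := hdeg w0
    rw [deg_split hF] at h1
    have : 2 ≤ eT G w0 (WW F) := by
      have m0 : w0 ∈ WW F := by simp [hW]
      have m1 : w1 ∈ WW F := by simp [hW]
      have m2 : w2 ∈ WW F := by simp [hW]
      have m3 : w3 ∈ WW F := by simp [hW]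
      have m4 : w4 ∈ WW F := by simp [hW]
      have b1 : G.Adj w0 w2 := I0 hF hno m1 m0 m2 (Ne.symm n1) n5 n2 (fun h => h01 h.symm) h12
      have b2 : G.Adj w0 w3 := I0 hF hno m4 m0 m3 (Ne.symm n4) (Ne.symm n10) n3 h40 (fun h => h34 h.symm)
      have : ({w2, w3} : Finset V) ⊆ (WW F).filter (G.Adj w0) := by
        intro t; simp; rintro (rfl | rfl) <;> simp [*]
      have := card_le_card this
      rwa [card_pair n8] at this
    omega

lemma rot5 (a b c d e : V) : ({a, b, c, d, e} : Finset V) = {b, c, d, e, a} := by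
  ext t
  simp only [mem_insert, mem_singleton]
  constructor
  · rintro (h | h | h | h | h) <;> simp [h]
  · rintro (h | h | h | h | h) <;> simp [h]

lemma c5 {F : Finset (Finset V)} (hF : TF G F) (hno : ∀ F', TF G F' → F'.card ≠ F.card + 1)
    {w0 w1 w2 w3 w4 : V}
    (hW : WW F = {w0, w1, w2, w3, w4}) (hpos : 1 ≤ F.card)
    (hdeg : ∀ w, eT G w univ ≤ F.card + 2)
    (hnd : [w0, w1, w2, w3, w4].Nodup) (h01 : ¬ G.Adj w0 w1) (h12 : ¬ G.Adj w1 w2)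
    (h23 : ¬ G.Adj w2 w3)
    (h34 : ¬ G.Adj w3 w4) (h40 : ¬ G.Adj w4 w0) : False := by
  have hnd' := hnd
  simp only [List.nodup_cons, List.mem_cons, List.not_mem_nil, or_false, not_or] at hnd'
  obtain ⟨⟨n1, n2, n3, n4⟩, ⟨n5, n6, n7⟩, ⟨n8, n9⟩, n10, -⟩ := hnd'
  have d1 : [w1, w2, w3, w4, w0].Nodup := by
    have := (List.nodup_rotate (n := 1)).2 hnd
    exact this
  have d2 : [w2, w3, w4, w0, w1].Nodup := by
    have := (List.nodup_rotate (n := 2)).2 hnd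
    exact this
  have d3 : [w3, w4, w0, w1, w2].Nodup := by
    have := (List.nodup_rotate (n := 3)).2 hnd
    exact this
  have d4 : [w4, w0, w1, w2, w3].Nodup := by
    have := (List.nodup_rotate (n := 4)).2 hnd
    exact this
  have W1 := hW.trans (rot5 _ _ _ _ _)
  have W2 := W1.trans (rot5 _ _ _ _ _)
  have W3 := W2.trans (rot5 _ _ _ _ _)
  have W4 := W3.trans (rot5 _ _ _ _ _)
  obtain ⟨A0, B0⟩ := c5ineq hF hno hW hdeg hnd h01 h12 h34 h40
  obtain ⟨A1, B1⟩ := c5ineq hF hno W1 hdeg d1 h12 h23 h40 h01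
  obtain ⟨A2, B2⟩ := c5ineq hF hno W2 hdeg d2 h23 h34 h01 h12
  obtain ⟨A3, B3⟩ := c5ineq hF hno W3 hdeg d3 h34 h40 h12 h23
  obtain ⟨A4, B4⟩ := c5ineq hF hno W4 hdeg d4 h40 h01 h23 h34
  obtain ⟨T, hT⟩ := card_pos.1 hpos
  have hex : ∃ T ∈ F, eT G w0 T + eT G w1 T + eT G w2 T + eT G w3 T + eT G w4 T ≤ 5 := by
    by_contra hcon
    push Not at hcon
    have := card_nsmul_le_sum F _ 6 (fun T hT => hcon T hT)
    simp only [sum_add_distrib, smul_eq_mul] at this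
    omega
  obtain ⟨T, hT, hle⟩ := hex
  have := A0 T hT
  have := A1 T hT
  have := A2 T hT
  have := A3 T hT
  have := A4 T hT
  obtain ⟨f0, g0, k0⟩ := eT_one (show eT G w0 T = 1 by omega)
  obtain ⟨f1, g1, k1⟩ := eT_one (show eT G w1 T = 1 by omega)
  obtain ⟨f2, g2, k2⟩ := eT_one (show eT G w2 T = 1 by omega)
  obtain ⟨f3, g3, k3⟩ := eT_one (show eT G w3 T = 1 by omega)
  obtain ⟨f4, g4, k4⟩ := eT_one (show eT G w4 T = 1 by omega)
  have m0 : w0 ∈ WW F := by simp [hW]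
  have m1 : w1 ∈ WW F := by simp [hW]
  have m2 : w2 ∈ WW F := by simp [hW]
  have m3 : w3 ∈ WW F := by simp [hW]
  have m4 : w4 ∈ WW F := by simp [hW]
  have s0 := c5step hF hno hT m0 m1 m2 m3 m4 hnd h12 h34 g0 k0 k1 k2 k3 k4
  have s1 := c5step hF hno hT m1 m2 m3 m4 m0 d1 h23 h40 g1 k1 k2 k3 k4 k0
  have s2 := c5step hF hno hT m2 m3 m4 m0 m1 d2 h34 h01 g2 k2 k3 k4 k0 k1
  have s3 := c5step hF hno hT m3 m4 m0 m1 m2 d3 h40 h12 g3 k3 k4 k0 k1 k2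
  have s4 := c5step hF hno hT m4 m0 m1 m2 m3 d4 h01 h23 g4 k4 k0 k1 k2 k3
  have t0 : f0 = f2 := s0.2.resolve_left s4.1
  have t2 : f2 = f4 := s2.2.resolve_left s1.1
  have t4 : f4 = f1 := s4.2.resolve_left s3.1
  exact s4.1 (t0.trans (t2.trans t4))

/-- two-clique structure -/
def Str (G : SimpleGraph V) (W X Y : Finset V) (N : ℕ) : Prop :=
  Disjoint X Y ∧ X ∪ Y = W ∧ X.card = N ∧ Y.card = N + 1 ∧
  (∀ a ∈ X, ∀ b ∈ X, a ≠ b → G.Adj a b) ∧ (∀ a ∈ Y, ∀ b ∈ Y, a ≠ b → G.Adj a b) ∧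
  ∀ x ∈ X, ∀ y ∈ Y, ¬ G.Adj x y

lemma lemA {F : Finset (Finset V)} (hF : TF G F) (hno : ∀ F', TF G F' → F'.card ≠ F.card + 1)
    {N : ℕ} (hN : 2 ≤ N) (hW : (WW F).card = 2 * N + 1) (hr : 1 ≤ F.card ∨ 3 ≤ N)
    (hdeg : ∀ w, eT G w univ ≤ F.card + N) {m : V → V} (hm : MM G (WW F) m) {v : V}
    (hv : fx (WW F) m = {v}) : ∃ X Y, Str G (WW F) X Y N := by
  obtain ⟨hvW, hvm, hfx⟩ := fx_facts hm hv
  have J := lemJ hF hno hN hW hdeg hm hv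
  set W := WW F with hWdef
  have hvfx : v ∈ fx W m := by simp [hv]
  set X := (W.erase v).filter (fun w => ¬ G.Adj v w) with hX
  set Y0 := (W.erase v).filter (fun w => G.Adj v w) with hY0
  have mX : ∀ w, w ∈ X ↔ (w ≠ v ∧ w ∈ W) ∧ ¬ G.Adj v w := by intro w; simp [hX]
  have mY : ∀ w, w ∈ Y0 ↔ (w ≠ v ∧ w ∈ W) ∧ G.Adj v w := by intro w; simp [hY0]
  have hXY : ∀ w ∈ X, m w ∈ Y0 := by
    intro w hw
    rw [mX] at hw; rw [mY]
    obtain ⟨q1, q2, q3⟩ := hfx w hw.1.2 hw.1.1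
    have := J w hw.1.2 hw.1.1
    exact ⟨⟨q3, q1⟩, by tauto⟩
  have hYX : ∀ w ∈ Y0, m w ∈ X := by
    intro w hw
    rw [mY] at hw; rw [mX]
    obtain ⟨q1, q2, q3⟩ := hfx w hw.1.2 hw.1.1
    have := J w hw.1.2 hw.1.1
    exact ⟨⟨q3, q1⟩, by tauto⟩
  have hXW : ∀ w ∈ X, w ∈ W := fun w hw => ((mX w).1 hw).1.2
  have hYW : ∀ w ∈ Y0, w ∈ W := fun w hw => ((mY w).1 hw).1.2
  have hcXY : X.card = Y0.card := by
    refine Finset.card_bij' (fun w _ => m w) (fun w _ => m w) hXY hYX ?_ ?_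
    · intro w hw; exact (hm w (hXW w hw)).2.1
    · intro w hw; exact (hm w (hYW w hw)).2.1
  have hcs : Y0.card + X.card = 2 * N := by
    have := card_filter_add_card_filter_not (s := W.erase v) (fun w => G.Adj v w)
    rw [card_erase_of_mem hvW, hW] at this
    exact this
  have Xcl : ∀ a ∈ X, ∀ b ∈ X, a ≠ b → G.Adj a b := by
    intro a ha b hb hab
    have h1 := (mX a).1 ha
    have h2 := (mX b).1 hb
    exact I0 hF hno hvW h1.1.2 h2.1.2 h1.1.1.symm h2.1.1.symm hab h1.2 h2.2
  -- single y
  have Jy : ∀ y ∈ Y0, ∀ y' ∈ Y0, y ≠ y' → (G.Adj y y' ↔ ¬ G.Adj y (m y')) := by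
    intro y hy y' hy' hne
    have h1 := (mY y).1 hy
    have h2 := (mY y').1 hy'
    obtain ⟨q1, q2, q3⟩ := hfx y h1.1.2 h1.1.1
    obtain ⟨m', a1, a2, a3, a4, a5⟩ := moveP hm hvfx h1.1.2 q2 ((mX _).1 (hYX y hy)).2
    have := lemJ hF hno hN hW hdeg a1 (v := y) (by rw [a2, hv]; simp) y' h2.1.2 hne.symm
    rwa [a5 y' h2.1.1 hne.symm] at this
    intro e
    have := (mX _).1 (hYX y hy)
    rw [← e] at this
    exact this.2 h2.2
  have Ycl : ∀ a ∈ Y0, ∀ b ∈ Y0, a ≠ b → G.Adj a b := by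
    intro y hy y' hy' hne
    by_contra hnadj
    -- single x'
    have key : ∀ y ∈ Y0, ∀ y' ∈ Y0, y ≠ y' → ¬ G.Adj y y' → ∀ z ∈ Y0, z ≠ y → z ≠ y' →
        ¬ G.Adj (m y') z := by
      intro y hy y' hy' hne hnadj z hz hzy hzy'
      have h1 := (mY y).1 hy
      have h2 := (mY y').1 hy'
      have h3 := (mY z).1 hz
      obtain ⟨q1, q2, q3⟩ := hfx y h1.1.2 h1.1.1
      obtain ⟨r1, r2, r3⟩ := hfx y' h2.1.2 h2.1.1
      have xz := hYX z hz
      have xy := hYX y hy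
      have xy' := hYX y' hy'
      have inj : ∀ a ∈ Y0, ∀ b ∈ Y0, m a = m b → a = b := by
        intro a ha b hb e
        rw [← (hm a (hYW a ha)).2.1, e, (hm b (hYW b hb)).2.1]
      have dis : ∀ a ∈ X, ∀ b ∈ Y0, a ≠ b := by
        rintro a ha b hb rfl
        exact ((mX _).1 ha).2 ((mY _).1 hb).2
      obtain ⟨m', a1, a2, a3, a4, a5⟩ := moveP hm hvfx h1.1.2 q2 ((mX _).1 xy).2
      have c1 : m' (m y') = y' := by
        rw [a5 (m y') r3 (dis _ xy' _ hy) (fun e => hne (inj _ hy' _ hy e).symm)]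
        exact (hm y' h2.1.2).2.1
      obtain ⟨m'', b1, b2, b3, b4, b5⟩ := moveP a1 (v := y) (z := m y') (by rw [a2]; simp) r1
        (by rw [c1]; exact r2.symm) (by rw [c1]; exact hnadj)
      have J' := lemJ hF hno hN hW hdeg b1 (v := m y') (by rw [b2, a2, hv]; simp) z h3.1.2
        (dis _ xy' _ hz).symm
      have c2 : m'' z = m z := by
        rw [b5 z hzy (dis _ xy' _ hz).symm (by rw [c1]; exact hzy'),
          a5 z h3.1.1 hzy (dis _ xy _ hz).symm]
      rw [c2] at J'
      have := Xcl _ xy' _ xz (fun e => hzy' (inj _ hy' _ hz e).symm)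
      tauto
    have h1 := (mY y).1 hy
    have h2 := (mY y').1 hy'
    obtain ⟨q1, q2, q3⟩ := hfx y h1.1.2 h1.1.1
    obtain ⟨r1, r2, r3⟩ := hfx y' h2.1.2 h2.1.1
    have xy := (mX _).1 (hYX y hy)
    have xy' := (mX _).1 (hYX y' hy')
    have nn : m y ≠ m y' := by
      intro e; apply hne; rw [← (hm y h1.1.2).2.1, e, (hm y' h2.1.2).2.1]
    have n1 : m y ≠ y' := by intro e; rw [e] at xy; exact xy.2 h2.2
    have n2 : m y' ≠ y := by intro e; rw [e] at xy'; exact xy'.2 h1.2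
    by_cases h3N : 3 ≤ N
    · have : 0 < (Y0 \ {y, y'}).card := by
        have := le_card_sdiff {y, y'} Y0
        have := card_le_two (a := y) (b := y')
        omega
      obtain ⟨z, hz⟩ := card_pos.1 this
      simp only [mem_sdiff, mem_insert, mem_singleton, not_or] at hz
      obtain ⟨hz, hzy, hzy'⟩ := hz
      change z ≠ y at hzy
      change z ≠ y' at hzy'
      have h3 := (mY z).1 hz
      have xz := (mX _).1 (hYX z hz)
      have e1 := key y hy y' hy' hne hnadj z hz hzy hzy'
      have e2 := key y' hy' y hy hne.symm (fun h => hnadj h.symm) z hz hzy' hzy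
      have zdis : ∀ t ∈ Y0, m t ≠ z := by
        intro t ht e
        have := (mX _).1 (hYX t ht)
        rw [e] at this; exact this.2 h3.2
      have e3 : G.Adj y z := I0 hF hno q1 h1.1.2 h3.1.2 q2 (zdis y hy) hzy.symm
        (fun h => (hm y h1.1.2).2.2 h.symm) e2
      have e4 : G.Adj y' z := I0 hF hno r1 h2.1.2 h3.1.2 r2 (zdis y' hy') hzy'.symm
        (fun h => (hm y' h2.1.2).2.2 h.symm) e1
      have e5 := (Jy y hy z hz hzy.symm).1 e3
      have e6 := (Jy y' hy' z hz hzy'.symm).1 e4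
      have ydis : ∀ t ∈ Y0, t ≠ m z := by
        rintro t ht e
        rw [← e] at xz; exact xz.2 ((mY t).1 ht).2
      exact e6 (I0 hF hno h1.1.2 h2.1.2 xz.1.2 hne (ydis y hy) (ydis y' hy') hnadj e5)
    · have hN2 : N = 2 := by omega
      subst hN2
      have hnd : [v, m y, y, y', m y'].Nodup := by
        simp only [List.nodup_cons, List.mem_cons, List.not_mem_nil, or_false, not_or]
        exact ⟨⟨q3.symm, h1.1.1.symm, h2.1.1.symm, r3.symm⟩, ⟨q2, n1, nn⟩, ⟨hne, n2.symm⟩, r2.symm,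
          not_false, List.nodup_nil⟩
      refine c5 hF hno (w0 := v) (w1 := m y) (w2 := y) (w3 := y') (w4 := m y') ?_ (by omega) hdeg
        hnd xy.2 (fun h => (hm y h1.1.2).2.2 h.symm) hnadj (hm y' h2.1.2).2.2
        (fun h => xy'.2 h.symm)
      symm
      apply eq_of_subset_of_card_le
      · intro t
        simp only [mem_insert, mem_singleton]
        rintro (rfl | rfl | rfl | rfl | rfl)
        · exact hvW
        · exact q1
        · exact h1.1.2
        · exact h2.1.2
        · exact r1
      · rw [hW]
        have := List.toFinset_card_of_nodup hnd
        simp only [List.toFinset_cons, List.toFinset_nil, List.length_cons, List.length_nil] at this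
        exact this.symm.le
  refine ⟨X, insert v Y0, ?_, ?_, ?_, ?_, Xcl, ?_, ?_⟩
  · rw [Finset.disjoint_left]
    intro w hw hw'
    rw [mX] at hw
    rw [mem_insert, mY] at hw'
    tauto
  · ext w
    rw [mem_union, mem_insert, mX, mY]
    by_cases e : w = v
    · simp [e, hvW]
    · tauto
  · omega
  · rw [card_insert_of_notMem (by rw [mY]; tauto)]; omega
  · intro a ha b hb hab
    rw [mem_insert] at ha hb
    rcases ha with rfl | ha <;> rcases hb with rfl | hb
    · exact absurd rfl hab
    · exact ((mY b).1 hb).2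
    · exact ((mY a).1 ha).2.symm
    · exact Ycl a ha b hb hab
  · intro x hx y hy
    rw [mem_insert] at hy
    have h1 := (mX x).1 hx
    rcases hy with rfl | hy
    · exact fun h => h1.2 h.symm
    · have hmx := hXY x hx
      have emx := (hm x (hXW x hx)).2.1
      by_cases e : y = m x
      · rw [e]; exact (hm x (hXW x hx)).2.2
      · have := (Jy y hy (m x) hmx e).1 (Ycl y hy _ hmx e)
        rw [emx] at this
        exact fun h => this h.symm

lemma lemP {F : Finset (Finset V)} (hF : TF G F) (hno : ∀ F', TF G F' → F'.card ≠ F.card + 1)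
    {T : Finset V} (hT : T ∈ F) {P Q : Finset V} (hP : P ⊆ WW F) (hQ : Q ⊆ WW F)
    (hd : Disjoint P Q) (hn : ∀ p ∈ P, ∀ q ∈ Q, ¬ G.Adj p q) {p0 : V} (hp0 : p0 ∈ P)
    (h0 : eT G p0 T = 0) (hs : ∑ p ∈ P, eT G p T < (P.card - 1) * 2) :
    ∀ q ∈ Q, ∀ t ∈ T, G.Adj q t := by
  intro q hq t ht
  by_contra hqt
  rw [Finset.disjoint_left] at hd
  have ne : ∀ p ∈ P, p ≠ q := by rintro p hp rfl; exact hd hp hq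
  have h1 : ∀ p ∈ P, p ≠ p0 → G.Adj p t := by
    intro p hp hpp
    by_contra hpt
    exact I1 hF hno hT (hP hp0) (hP hp) (hQ hq) hpp.symm (ne p0 hp0) (ne p hp) (hn p hp q hq) ht
      hpt hqt (fun t' ht' _ => eT_zero.1 h0 t' ht')
  have h2 : ∃ p ∈ P.erase p0, eT G p T < 2 := by
    by_contra hcon
    push Not at hcon
    have h3 := card_nsmul_le_sum _ _ _ hcon
    rw [card_erase_of_mem hp0, smul_eq_mul] at h3
    rw [← add_sum_erase _ _ hp0] at hs
    omega
  obtain ⟨p1, hp1, hlt⟩ := h2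
  rw [mem_erase] at hp1
  have h4 := h1 p1 hp1.2 hp1.1
  have h5 : eT G p1 T ≠ 0 := fun e => eT_zero.1 e t ht h4
  obtain ⟨a, ha, hat⟩ := eT_one (show eT G p1 T = 1 by omega)
  have hta := (hat t ht).1 h4
  exact I1 hF hno hT (hP hp1.2) (hP hp0) (hQ hq) hp1.1 (ne p1 hp1.2) (ne p0 hp0) (hn p0 hp0 q hq) ht
      (eT_zero.1 h0 t ht) hqt (fun t' ht' hne h => hne (by rw [(hat t' ht').1 h, hta]))

lemma lemP2 {F : Finset (Finset V)} (hF : TF G F) (hno : ∀ F', TF G F' → F'.card ≠ F.card + 1)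
    {T : Finset V} (hT : T ∈ F) {P Q : Finset V} (hP : P ⊆ WW F) (hQ : Q ⊆ WW F)
    (hd : Disjoint P Q) (hn : ∀ p ∈ P, ∀ q ∈ Q, ¬ G.Adj p q) (h2 : 2 ≤ P.card)
    (hs : ∑ p ∈ P, eT G p T < P.card) :
    ∑ q ∈ Q, eT G q T = 3 * Q.card := by
  have : ∃ p0 ∈ P, eT G p0 T = 0 := by
    by_contra hcon
    push Not at hcon
    have := card_nsmul_le_sum P (fun p => eT G p T) 1 (fun p hp => Nat.one_le_iff_ne_zero.2 (hcon p hp))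
    rw [smul_eq_mul] at this
    omega
  obtain ⟨p0, hp0, h0⟩ := this
  have h := lemP hF hno hT hP hQ hd hn hp0 h0 (by omega)
  rw [sum_congr rfl (fun q hq => (eT_full (h q hq)).trans (hF.1 T hT).1), sum_const, smul_eq_mul,
    mul_comm]

lemma lemCount {F : Finset (Finset V)} (hF : TF G F) (hno : ∀ F', TF G F' → F'.card ≠ F.card + 1)
    {N : ℕ} (hN : 2 ≤ N)
    (hdeg : ∀ w, eT G w univ ≤ F.card + N) {X Y : Finset V} (hS : Str G (WW F) X Y N) :
    ∀ T ∈ F, ∑ y ∈ Y, eT G y T = N + 1 ∧ ∑ x ∈ X, eT G x T ≤ 2 * N := by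
  obtain ⟨hd, hun, cX, cY, Xcl, Ycl, hn⟩ := hS
  have hXW : X ⊆ WW F := by rw [← hun]; exact subset_union_left
  have hYW : Y ⊆ WW F := by rw [← hun]; exact subset_union_right
  have dX : ∀ x ∈ X, ∑ T ∈ F, eT G x T ≤ F.card + 1 := by
    intro x hx
    have h1 := hdeg x
    rw [deg_split hF] at h1
    have : X.erase x ⊆ (WW F).filter (G.Adj x) := by
      intro t ht
      rw [mem_erase] at ht
      exact mem_filter.2 ⟨hXW ht.2, Xcl x hx t ht.2 ht.1.symm⟩
    have := card_le_card this
    rw [card_erase_of_mem hx] at this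
    unfold eT at h1 ⊢
    omega
  have dY : ∀ x ∈ Y, ∑ T ∈ F, eT G x T ≤ F.card := by
    intro x hx
    have h1 := hdeg x
    rw [deg_split hF] at h1
    have : Y.erase x ⊆ (WW F).filter (G.Adj x) := by
      intro t ht
      rw [mem_erase] at ht
      exact mem_filter.2 ⟨hYW ht.2, Ycl x hx t ht.2 ht.1.symm⟩
    have := card_le_card this
    rw [card_erase_of_mem hx] at this
    unfold eT at h1 ⊢
    omega
  have sX : ∑ T ∈ F, ∑ x ∈ X, eT G x T ≤ N * (F.card + 1) := by
    rw [sum_comm, ← cX, ← smul_eq_mul]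
    exact sum_le_card_nsmul _ _ _ dX
  have sY : ∑ T ∈ F, ∑ x ∈ Y, eT G x T ≤ (N + 1) * F.card := by
    rw [sum_comm, ← cY, ← smul_eq_mul]
    exact sum_le_card_nsmul _ _ _ dY
  have bY : ∀ T ∈ F, ∑ y ∈ Y, eT G y T < N + 1 → ∑ x ∈ X, eT G x T = 3 * N := by
    intro T hT h
    rw [← cY] at h
    rw [← cX]
    exact lemP2 hF hno hT hYW hXW hd.symm (fun p hp q hq h => hn q hq p hp h.symm) (by omega) h
  have bX : ∀ T ∈ F, ∑ y ∈ X, eT G y T < N → ∑ x ∈ Y, eT G x T = 3 * (N + 1) := by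
    intro T hT h
    rw [← cX] at h
    rw [← cY]
    exact lemP2 hF hno hT hXW hYW hd hn (by omega) h
  set p := (F.filter fun T => ∑ y ∈ Y, eT G y T < N + 1).card with hp
  set q := (F.filter fun T => ∑ x ∈ X, eT G x T < N).card with hq
  have e1 : F.card * N + p * (2 * N) ≤ ∑ T ∈ F, ∑ x ∈ X, eT G x T + q * N := by
    rw [hp, hq, card_filter, card_filter, sum_mul, sum_mul, ← smul_eq_mul, ← sum_const,
      ← sum_add_distrib, ← sum_add_distrib]
    apply sum_le_sum
    intro T hT
    have := bY T hT
    have := bX T hT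
    split_ifs <;> omega
  have e2 : F.card * (N + 1) + q * (2 * (N + 1)) ≤ ∑ T ∈ F, ∑ x ∈ Y, eT G x T + p * (N + 1) := by
    rw [hp, hq, card_filter, card_filter, sum_mul, sum_mul, ← smul_eq_mul, ← sum_const,
      ← sum_add_distrib, ← sum_add_distrib]
    apply sum_le_sum
    intro T hT
    have := bY T hT
    have := bX T hT
    split_ifs <;> omega
  have e3 : N * (2 * p) ≤ N * (1 + q) := by nlinarith
  have e4 : (N + 1) * (2 * q) ≤ (N + 1) * p := by nlinarith
  have e5 := Nat.le_of_mul_le_mul_left e3 (by omega)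
  have e6 := Nat.le_of_mul_le_mul_left e4 (by omega)
  have p0 : p = 0 := by omega
  have q0 : q = 0 := by omega
  rw [hp, card_eq_zero, filter_eq_empty_iff] at p0
  rw [hq, card_eq_zero, filter_eq_empty_iff] at q0
  intro T hT
  have r1 : (F.erase T).card * N ≤ ∑ T ∈ F.erase T, ∑ x ∈ X, eT G x T := by
    rw [← smul_eq_mul]
    exact card_nsmul_le_sum _ _ _ (fun S hS => not_lt.1 (q0 (mem_of_mem_erase hS)))
  have r2 : (F.erase T).card * (N + 1) ≤ ∑ T ∈ F.erase T, ∑ x ∈ Y, eT G x T := by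
    rw [← smul_eq_mul]
    exact card_nsmul_le_sum _ _ _ (fun S hS => not_lt.1 (p0 (mem_of_mem_erase hS)))
  rw [← add_sum_erase _ _ hT, ← card_erase_add_one hT] at sX sY
  have r3 := not_lt.1 (p0 hT)
  refine ⟨le_antisymm ?_ r3, ?_⟩ <;> nlinarith

lemma lemC {F : Finset (Finset V)} (hF : TF G F) (hno : ∀ F', TF G F' → F'.card ≠ F.card + 1)
    {N : ℕ} (hN : 2 ≤ N) (hW : (WW F).card = 2 * N + 1)
    (hdeg : ∀ w, eT G w univ ≤ F.card + N) {X Y : Finset V} (hS : Str G (WW F) X Y N) :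
    ∀ T ∈ F, ∃ a ∈ T, ∀ y ∈ Y, ∀ t ∈ T, G.Adj y t ↔ t = a := by
  intro T hT
  obtain ⟨hsY, hsX⟩ := lemCount hF hno hN hdeg hS T hT
  obtain ⟨hd, hun, cX, cY, Xcl, Ycl, hn⟩ := hS
  have hXW : X ⊆ WW F := by rw [← hun]; exact subset_union_left
  have hYW : Y ⊆ WW F := by rw [← hun]; exact subset_union_right
  have hT3 := (hF.1 T hT).1
  have hd' := Finset.disjoint_left.1 hd
  have neXY : ∀ x ∈ X, ∀ y ∈ Y, x ≠ y := by rintro x hx y hy rfl; exact hd' hx hy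
  have notfull : ¬ ∀ x ∈ X, ∀ t ∈ T, G.Adj x t := by
    intro h
    rw [sum_congr rfl (fun q hq => (eT_full (h q hq)).trans hT3), sum_const, smul_eq_mul, cX] at hsX
    omega
  have ge1 : ∀ y ∈ Y, 1 ≤ eT G y T := by
    intro y hy
    by_contra h
    exact notfull (lemP hF hno hT hYW hXW hd.symm (fun p hp q hq h => hn q hq p hp h.symm) hy
      (by omega) (by rw [hsY, cY]; omega))
  have eq1 : ∀ y ∈ Y, eT G y T = 1 := by
    intro y hy
    have := (sum_eq_sum_iff_of_le ge1).1 (by rw [hsY, sum_const, cY]; simp)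
    exact (this y hy).symm
  have hf : ∀ y ∈ Y, ∃ a ∈ T, ∀ t ∈ T, G.Adj y t ↔ t = a := fun y hy => eT_one (eq1 y hy)
  -- unusable
  have hor : ∀ y ∈ Y, ∀ f ∈ T, G.Adj y f → ∀ x ∈ X, ∀ y' ∈ Y, ¬ G.Adj y' f → G.Adj x f := by
    intro y hy f hfT hyf x hx y' hy' hy'f
    by_contra hxf
    obtain ⟨a, ha, hat⟩ := hf y hy
    have hfa := (hat f hfT).1 hyf
    refine I1 hF hno hT (hYW hy) (hXW hx) (hYW hy') (neXY x hx y hy).symm ?_ (neXY x hx y' hy')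
      (hn x hx y' hy') hfT hxf hy'f ?_
    · rintro rfl; exact hy'f hyf
    · intro t ht hne h
      exact hne (by rw [(hat t ht).1 h, hfa])
  obtain ⟨y1, hy1⟩ := card_pos.1 (by omega : 0 < Y.card)
  obtain ⟨b, hb, hbt⟩ := hf y1 hy1
  refine ⟨b, hb, ?_⟩
  by_contra hcon
  have : ∃ y2 ∈ Y, ¬ G.Adj y2 b := by
    by_contra h
    push Not at h
    apply hcon
    intro y hy t ht
    obtain ⟨a, ha, hat⟩ := hf y hy
    rw [(hat b hb).1 (h y hy)]
    exact hat t ht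
  obtain ⟨y2, hy2, hy2b⟩ := this
  obtain ⟨a, ha, hat⟩ := hf y2 hy2
  have hab : a ≠ b := by rintro rfl; exact hy2b ((hat _ hb).2 rfl)
  have hy1a : ¬ G.Adj y1 a := by rw [hbt a ha]; exact hab
  have hy12 : y1 ≠ y2 := by rintro rfl; exact hy1a ((hat a ha).2 rfl)
  have Xa : ∀ x ∈ X, G.Adj x a := fun x hx => hor y2 hy2 a ha ((hat a ha).2 rfl) x hx y1 hy1 hy1a
  have Xb : ∀ x ∈ X, G.Adj x b := fun x hx => hor y1 hy1 b hb ((hbt b hb).2 rfl) x hx y2 hy2 hy2b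
  -- third vertex
  have : 0 < (T \ {a, b}).card := by
    have := le_card_sdiff {a, b} T
    have := card_le_two (a := a) (b := b)
    omega
  obtain ⟨c, hc⟩ := card_pos.1 this
  simp only [mem_sdiff, mem_insert, mem_singleton, not_or] at hc
  obtain ⟨hc, hca, hcb⟩ := hc
  have hTabc : T = {a, b, c} := by
    symm
    apply eq_of_subset_of_card_le
    · intro t; simp only [mem_insert, mem_singleton]; rintro (rfl | rfl | rfl) <;> assumption
    · rw [hT3, card_eq_three.2 ⟨a, b, c, hab, Ne.symm hca, Ne.symm hcb, rfl⟩]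
  have exx : ∃ x ∈ X, ¬ G.Adj x c := by
    by_contra h
    push Not at h
    apply notfull
    intro x hx t ht
    rw [hTabc] at ht
    simp only [mem_insert, mem_singleton] at ht
    rcases ht with rfl | rfl | rfl
    · exact Xa x hx
    · exact Xb x hx
    · exact h x hx
  obtain ⟨x, hx, hxc⟩ := exx
  have Yc : ∀ y ∈ Y, ¬ G.Adj y c := by
    intro y hy h
    exact hxc (hor y hy c hc h x hx y1 hy1 (by rw [hbt c hc]; exact hcb))
  have : 0 < (Y \ {y1, y2}).card := by
    have := le_card_sdiff {y1, y2} Y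
    have := card_le_two (a := y1) (b := y2)
    omega
  obtain ⟨y, hy⟩ := card_pos.1 this
  simp only [mem_sdiff, mem_insert, mem_singleton, not_or] at hy
  obtain ⟨hy, hyy1, hyy2⟩ := hy
  obtain ⟨x', hx'⟩ := card_pos.1 (show 0 < (X.erase x).card by rw [card_erase_of_mem hx]; omega)
  have hxW := hXW hx
  have hyW := hYW hy
  have hxT := mem_WW.1 hxW T hT
  have hyT := mem_WW.1 hyW T hT
  obtain ⟨s1, s2, s3⟩ := tf_swap hF hT (T' := {c, x, y})
    (card_eq_three.2 ⟨c, x, y, fun e => hxT (e ▸ hc), fun e => hyT (e ▸ hc), neXY x hx y hy, rfl⟩)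
    (indep3 (fun h => hxc h.symm) (fun h => Yc y hy h.symm) (hn x hx y hy))
    (by intro t; simp only [mem_insert, mem_singleton, mem_union]
        rintro (rfl | rfl | rfl) <;> tauto)
  have WT : ∀ w ∈ WW F, w ∉ T := fun w hw => mem_WW.1 hw T hT
  have hx'2 := mem_erase.1 hx'
  -- matching
  have aX : ∀ w ∈ X, w ≠ a ∧ w ≠ b ∧ w ≠ c := fun w hw =>
    ⟨not_mem_W hT (hXW hw) ha, not_mem_W hT (hXW hw) hb, not_mem_W hT (hXW hw) hc⟩
  have aY : ∀ w ∈ Y, w ≠ a ∧ w ≠ b ∧ w ≠ c := fun w hw =>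
    ⟨not_mem_W hT (hYW hw) ha, not_mem_W hT (hYW hw) hb, not_mem_W hT (hYW hw) hc⟩
  obtain ⟨m0, f1, f2⟩ := MM_bip (G := G) (N - 2) ((X.erase x).erase x') (((Y.erase y).erase y1).erase y2)
    (by rw [card_erase_of_mem hx', card_erase_of_mem hx]; omega)
    (by rw [card_erase_of_mem (by simp [hy2, hy12.symm, Ne.symm hyy2]),
          card_erase_of_mem (by simp [hy1, Ne.symm hyy1]), card_erase_of_mem hy]; omega)
    (by rw [Finset.disjoint_left]; intro t h1 h2; simp only [mem_erase] at h1 h2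
        exact hd' h1.2.2 h2.2.2.2)
    (by intro p hp q hq; simp only [mem_erase] at hp hq; exact hn p hp.2.2 q hq.2.2.2)
  have y1X : y1 ∉ X := fun h => hd' h hy1
  have y2X : y2 ∉ X := fun h => hd' h hy2
  have x'Y : x' ∉ Y := hd' hx'2.2
  obtain ⟨m1, g1, g2⟩ := addSingle f1 (p := x') (by simp [x'Y])
  have aXn : a ∉ X := fun h => (aX a h).1 rfl
  have aYn : a ∉ Y := fun h => (aY a h).1 rfl
  have bXn : b ∉ X := fun h => (aX b h).2.1 rfl
  have bYn : b ∉ Y := fun h => (aY b h).2.1 rfl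
  obtain ⟨m2, i1, i2⟩ := addPair g1 (p := a) (q := y1)
    (by simp [aXn, aYn, ((aX x' hx'2.2).1).symm])
    (by simp [y1X, (neXY x' hx'2.2 y1 hy1).symm]) ((aY y1 hy1).1).symm (fun h => hy1a h.symm)
  obtain ⟨m3, j1, j2⟩ := addPair i1 (p := b) (q := y2)
    (by simp [bXn, bYn, ((aX x' hx'2.2).2.1).symm, hab.symm, ((aY y1 hy1).2.1).symm])
    (by simp [y2X, (neXY x' hx'2.2 y2 hy2).symm, (aY y2 hy2).1, hy12.symm])
    ((aY y2 hy2).2.1).symm (fun h => hy2b h.symm)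
  have hWeq : insert b (insert y2 (insert a (insert y1 (insert x' ((X.erase x).erase x' ∪ ((Y.erase y).erase y1).erase y2)))))
      = WW (insert {c, x, y} (F.erase T)) := by
    rw [s3, ← hun, hTabc]
    ext t
    simp only [mem_insert, mem_union, mem_erase, mem_sdiff, mem_singleton, not_or]
    have q1 : t ∈ X → t ≠ c := fun h => (aX t h).2.2
    have q2 : t ∈ Y → t ≠ c := fun h => (aY t h).2.2
    have q3 : t ∈ X → t ≠ y := fun h => neXY t h y hy
    have q4 : t ∈ Y → t ≠ x := fun h => (neXY x hx t h).symm
    have z1 := aX x hx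
    have z2 := aY y hy
    by_cases tX : t ∈ X
    · have tY : t ∉ Y := hd' tX
      have := q1 tX
      have := q3 tX
      have := hx'2.1
      clear * - tX tY this hx'2 hy1 hy2 y1X y2X q1 q3 hy aX
      have := aX t tX
      grind
    · by_cases tY : t ∈ Y
      · have := q2 tY
        have := q4 tY
        have := aY t tY
        clear * - tX tY q2 q4 this hx'2 hy1 hy2 hy hyy1 hyy2
        grind
      · clear * - tX tY hx'2 hx hy1 hy2 hy hca hcb z1 z2
        grind
  rw [hWeq] at j1 j2
  have hcard : (WW (insert {c, x, y} (F.erase T))).card = 2 * N + 1 := by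
    have h1 := card_split hF
    have h2 := card_split s1
    rw [s2] at h2
    omega
  obtain ⟨X', Y', -, hun', -, -, X'cl, Y'cl, hn'⟩ := lemA s1 (by rw [s2]; exact hno) hN hcard
    (Or.inl (by rw [s2]; exact card_pos.2 ⟨T, hT⟩)) (by rw [s2]; exact hdeg) j1 (v := x')
    (by rw [j2, i2, g2, f2]; rfl)
  have trans : ∀ u ∈ X' ∪ Y', ∀ v ∈ X' ∪ Y', ∀ w ∈ X' ∪ Y', u ≠ w → G.Adj u v → G.Adj v w → G.Adj u w := by
    intro u hu v hv w hw hne h1 h2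
    rw [mem_union] at hu hv hw
    rcases hu with hu | hu <;> rcases hv with hv | hv <;> rcases hw with hw | hw
    · exact X'cl u hu w hw hne
    · exact absurd h2 (hn' v hv w hw)
    · exact X'cl u hu w hw hne
    · exact absurd h1 (hn' u hu v hv)
    · exact absurd h1.symm (hn' v hv u hu)
    · exact Y'cl u hu w hw hne
    · exact absurd h2.symm (hn' w hw v hv)
    · exact Y'cl u hu w hw hne
  rw [hun', ← hWeq] at trans
  have := trans x' (by simp) a (by simp) y2 (by simp) (neXY x' hx'2.2 y2 hy2) (Xa x' hx'2.2)
    ((hat a ha).2 rfl).symm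
  exact hn x' hx'2.2 y2 hy2 this

lemma lemD {F : Finset (Finset V)} (hF : TF G F) (hno : ∀ F', TF G F' → F'.card ≠ F.card + 1)
    {N : ℕ} (hN : 2 ≤ N) (hW : (WW F).card = 2 * N + 1) (hr : 1 ≤ F.card ∨ 3 ≤ N)
    (hdeg : ∀ w, eT G w univ ≤ F.card + N) {m : V → V} (hm : MM G (WW F) m) {v : V}
    (hv : fx (WW F) m = {v}) (hcf : G.CliqueFree (F.card + N + 1)) : False := by
  obtain ⟨X, Y, hS⟩ := lemA hF hno hN hW hr hdeg hm hv
  have hC := lemC hF hno hN hW hdeg hS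
  obtain ⟨hd, hun, cX, cY, Xcl, Ycl, hn⟩ := hS
  have hXW : X ⊆ WW F := by rw [← hun]; exact subset_union_left
  have hYW : Y ⊆ WW F := by rw [← hun]; exact subset_union_right
  have hd' := Finset.disjoint_left.1 hd
  obtain ⟨y, hy⟩ := card_pos.1 (by omega : 0 < Y.card)
  obtain ⟨y1, hy1'⟩ := card_pos.1 (show 0 < (Y.erase y).card by rw [card_erase_of_mem hy]; omega)
  have hy1 := mem_erase.1 hy1'
  have : Nonempty V := ⟨y⟩
  choose! a haT ha using hC
  have adj : ∀ T ∈ F, ∀ T' ∈ F, T ≠ T' → G.Adj (a T) (a T') := by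
    intro T hT T' hT' hne
    obtain ⟨F', k1, k2, k3, k4⟩ := swap1 hF hT (hYW hy) (haT T hT)
      (fun t ht hta h => hta ((ha T hT y hy t ht).1 h))
    have aW : a T ∉ WW F := fun h => mem_WW.1 h T hT (haT T hT)
    have aXn : a T ∉ X := fun h => aW (hXW h)
    have aYn : a T ∉ Y := fun h => aW (hYW h)
    obtain ⟨m0, f1, f2⟩ := MM_bip (G := G) N X (Y.erase y) cX (by rw [card_erase_of_mem hy]; omega)
      (by rw [Finset.disjoint_left]; intro t h1 h2; exact hd' h1 (mem_of_mem_erase h2))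
      (fun p hp q hq => hn p hp q (mem_of_mem_erase hq))
    obtain ⟨m1, g1, g2⟩ := addSingle f1 (p := a T) (by simp [aXn, aYn])
    have hWeq : insert (a T) (X ∪ Y.erase y) = WW F' := by
      rw [k3, ← hun]
      ext t
      simp only [mem_insert, mem_union, mem_erase]
      have : t ∈ X → t ≠ y := by rintro h rfl; exact hd' h hy
      tauto
    rw [hWeq] at g1 g2
    have hno' : ∀ F'', TF G F'' → F''.card ≠ F'.card + 1 := by rw [k2]; exact hno
    have hcard : (WW F').card = 2 * N + 1 := by
      have h1 := card_split hF
      have h2 := card_split k1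
      rw [k2] at h2
      omega
    have hdeg' : ∀ w, eT G w univ ≤ F'.card + N := by rw [k2]; exact hdeg
    obtain ⟨X', Y', hS'⟩ := lemA k1 hno' hN hcard (by rw [k2]; exact hr) hdeg' g1 (v := a T)
      (by rw [g2, f2]; rfl)
    have hC' := lemC k1 hno' hN hcard hdeg' hS'
    obtain ⟨-, hun', cX', cY', -, -, hn'⟩ := hS'
    obtain ⟨a', ha'T, ha'⟩ := hC' T' (k4 T' hT' hne.symm)
    have memW : ∀ w ∈ insert (a T) (Y.erase y), w ∈ X' ∪ Y' := by
      intro w hw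
      rw [hun', ← hWeq]
      simp only [mem_insert, mem_union] at hw ⊢
      tauto
    have adj1 : ∀ w ∈ insert (a T) (Y.erase y), w = y1 ∨ G.Adj y1 w := by
      intro w hw
      rw [mem_insert, mem_erase] at hw
      rcases hw with rfl | hw
      · right; exact (ha T hT y1 hy1.2 _ (haT T hT)).2 rfl
      · by_cases e : w = y1
        · exact Or.inl e
        · right; exact Ycl y1 hy1.2 w hw.2 (Ne.symm e)
    have y1Y' : y1 ∈ Y' := by
      by_contra hcon
      have y1X' : y1 ∈ X' := by
        have := memW y1 (mem_insert_of_mem hy1')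
        rw [mem_union] at this; tauto
      have : insert (a T) (Y.erase y) ⊆ X' := by
        intro w hw
        rcases adj1 w hw with rfl | h
        · exact y1X'
        · have := memW w hw
          rw [mem_union] at this
          rcases this with h1 | h1
          · exact h1
          · exact absurd h (hn' y1 y1X' w h1)
      have := card_le_card this
      rw [card_insert_of_notMem (by simp [aYn]), card_erase_of_mem hy] at this
      omega
    have aY' : a T ∈ Y' := by
      have h1 := memW (a T) (mem_insert_self _ _)
      rw [mem_union] at h1
      rcases h1 with h1 | h1
      · have h2 := (ha T hT y1 hy1.2 _ (haT T hT)).2 rfl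
        exact absurd h2.symm (hn' _ h1 y1 y1Y')
      · exact h1
    have e : a T' = a' := (ha' y1 y1Y' _ (haT T' hT')).1 ((ha T' hT' y1 hy1.2 _ (haT T' hT')).2 rfl)
    exact (ha' (a T) aY' (a T') (haT T' hT')).2 e
  have inj : Set.InjOn a F := by
    intro T hT T' hT' e
    by_contra hne
    have := adj T hT T' hT' hne
    rw [e] at this
    exact G.irrefl this
  refine hcf (Y ∪ F.image a) ⟨?_, ?_⟩
  · intro p hp q hq hpq
    rw [mem_coe, mem_union, mem_image] at hp hq
    rcases hp with hp | ⟨T, hT, rfl⟩ <;> rcases hq with hq | ⟨T', hT', rfl⟩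
    · exact Ycl p hp q hq hpq
    · exact (ha T' hT' p hp _ (haT T' hT')).2 rfl
    · exact ((ha T hT q hq _ (haT T hT)).2 rfl).symm
    · exact adj T hT T' hT' (by rintro rfl; exact hpq rfl)
  · rw [card_union_of_disjoint, card_image_of_injOn inj, cY]
    · omega
    · rw [Finset.disjoint_left]
      intro t ht h
      rw [mem_image] at h
      obtain ⟨T, hT, rfl⟩ := h
      exact mem_WW.1 (hYW ht) T hT (haT T hT)

end EqHelpers

section EqHelpers2

set_option linter.unusedSectionVars false

variable [Fintype V] [DecidableEq V] {G : SimpleGraph V} [DecidableRel G.Adj]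

lemma mem_fx {W : Finset V} {m : V → V} {u : V} : u ∈ fx W m ↔ u ∈ W ∧ m u = u := by
  simp [fx]

lemma joinP {W : Finset V} {m : V → V} (hm : MM G W m) {u v : V} (hu : u ∈ fx W m)
    (hv : v ∈ fx W m) (huv : u ≠ v) (h : ¬ G.Adj u v) :
    ∃ m', MM G W m' ∧ (fx W m').card < (fx W m).card := by
  rw [mem_fx] at hu hv
  refine ⟨fun w => if w = u then v else if w = v then u else m w, ?_, ?_⟩
  · intro w hw
    by_cases e : w = u
    · subst e; simp [huv.symm, h, hv.1]
    by_cases e' : w = v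
    · subst e'; simp [huv.symm, hu.1]; exact fun h' => h h'.symm
    obtain ⟨a1, a2, a3⟩ := hm w hw
    have b1 : m w ≠ u := by intro h'; rw [h', hu.2] at a2; exact e a2.symm
    have b2 : m w ≠ v := by intro h'; rw [h', hv.2] at a2; exact e' a2.symm
    simp [e, e', b1, b2, a1, a2, a3]
  · apply card_lt_card
    rw [ssubset_iff_of_subset]
    · refine ⟨u, mem_fx.2 hu, ?_⟩
      rw [mem_fx]; simp [huv.symm]
    · intro w hw
      rw [mem_fx] at hw ⊢
      by_cases e : w = u
      · subst e; exact hu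
      by_cases e' : w = v
      · subst e'; exact hv
      simpa [e, e'] using hw

/-- configuration with `r` triples and `c` fixed points -/
def Opt (G : SimpleGraph V) (r c : ℕ) (F : Finset (Finset V)) (m : V → V) : Prop :=
  TF G F ∧ F.card = r ∧ MM G (WW F) m ∧ (fx (WW F) m).card = c

lemma optC0 {r c : ℕ} (hmin : ∀ F m c', Opt G r c' F m → c ≤ c') {F : Finset (Finset V)}
    {m : V → V} (h : Opt G r c F m) {u v : V} (hu : u ∈ fx (WW F) m)
    (hv : v ∈ fx (WW F) m) (huv : u ≠ v) : G.Adj u v := by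
  by_contra hn
  obtain ⟨h1, h2, h3, h4⟩ := h
  obtain ⟨m', a1, a2⟩ := joinP h3 hu hv huv hn
  have := hmin F m' _ ⟨h1, h2, a1, rfl⟩
  omega

lemma optP {r c : ℕ} {F : Finset (Finset V)}
    {m : V → V} (h : Opt G r c F m) {u z : V} (hu : u ∈ fx (WW F) m)
    (hz : z ∈ WW F) (hzz : m z ≠ z) (huz : ¬ G.Adj u (m z)) :
    ∃ m', Opt G r c F m' ∧ fx (WW F) m' = insert z ((fx (WW F) m).erase u) := by
  obtain ⟨h1, h2, h3, h4⟩ := h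
  obtain ⟨m', a1, a2, -⟩ := moveP h3 hu hz hzz huz
  refine ⟨m', ⟨h1, h2, a1, ?_⟩, a2⟩
  rw [a2, card_insert_of_notMem, card_erase_add_one hu, h4]
  intro h; rw [mem_erase, mem_fx] at h; exact hzz h.2.2

lemma optT {r c : ℕ} {F : Finset (Finset V)}
    {m : V → V} (h : Opt G r c F m) {u a : V} {T : Finset V} (hu : u ∈ fx (WW F) m)
    (hT : T ∈ F) (ha : a ∈ T) (hua : ∀ t ∈ T, t ≠ a → ¬ G.Adj u t) :
    ∃ F' m', Opt G r c F' m' ∧ WW F' = insert a ((WW F).erase u) ∧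
      fx (WW F') m' = insert a ((fx (WW F) m).erase u) ∧ ∀ w, w ≠ a → m' w = m w := by
  obtain ⟨h1, h2, h3, h4⟩ := h
  have haW : a ∉ WW F := fun h => mem_WW.1 h T hT ha
  obtain ⟨F', b1, b2, b3, -⟩ := swap1 h1 hT (mem_fx.1 hu).1 ha hua
  obtain ⟨m', a1, a2, a3⟩ := moveT h3 hu haW
  rw [← b3] at a1 a2
  refine ⟨F', m', ⟨b1, by omega, a1, ?_⟩, b3, a2, a3⟩
  rw [a2, card_insert_of_notMem, card_erase_add_one hu, h4]
  intro h; rw [mem_erase, mem_fx] at h; exact haW h.2.1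

lemma optC1 {r c : ℕ} (hmin : ∀ F m c', Opt G r c' F m → c ≤ c') {F : Finset (Finset V)}
    {m : V → V} (h : Opt G r c F m) {u v w : V} (hu : u ∈ fx (WW F) m)
    (hv : v ∈ fx (WW F) m) (huv : u ≠ v) (hw : w ∈ WW F) (hww : m w ≠ w) :
    G.Adj u w ∨ G.Adj v (m w) := by
  by_contra hn
  push Not at hn
  obtain ⟨a1, a2, a3⟩ := h.2.2.1 w hw
  obtain ⟨m', b1, b2⟩ := optP h hu a1 (by rw [a2]; exact hww.symm) (by rw [a2]; exact hn.1)
  have hvw : v ≠ m w := by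
    rintro rfl; rw [mem_fx, a2] at hv; exact hww hv.2.symm
  exact hn.2 (optC0 hmin b1 (by rw [b2]; simp [huv.symm, hv]) (by rw [b2]; simp) hvw)

lemma optC2 {r c : ℕ} (hmin : ∀ F m c', Opt G r c' F m → c ≤ c') {F : Finset (Finset V)}
    {m : V → V} (h : Opt G r c F m) {u v a : V} {T : Finset V} (hu : u ∈ fx (WW F) m)
    (hv : v ∈ fx (WW F) m) (huv : u ≠ v)
    (hT : T ∈ F) (ha : a ∈ T) (hua : ∀ t ∈ T, t ≠ a → ¬ G.Adj u t) : G.Adj v a := by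
  obtain ⟨F', m', b1, b2, b3, -⟩ := optT h hu hT ha hua
  exact optC0 hmin b1 (by rw [b3]; simp [huv.symm, hv]) (by rw [b3]; simp)
    (not_mem_W hT (mem_fx.1 hv).1 ha)

lemma optT2 {r c : ℕ} (hmin : ∀ F m c', Opt G r c' F m → c ≤ c') {F : Finset (Finset V)}
    {m : V → V} (h : Opt G r c F m) {u v : V} {T : Finset V} (hu : u ∈ fx (WW F) m)
    (hv : v ∈ fx (WW F) m) (huv : u ≠ v) (hT : T ∈ F) :
    2 ≤ eT G u T + eT G v T ∧ (eT G u T + eT G v T = 2 →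
      ∃ a ∈ T, ∀ t ∈ T, (G.Adj u t ↔ t = a) ∧ (G.Adj v t ↔ t = a)) := by
  have h3 := (h.1.1 T hT).1
  have c1 : eT G u T = 0 → eT G v T = 3 := by
    intro h0
    rw [eT_zero] at h0
    rw [← h3]
    exact eT_full fun t ht => optC2 hmin h hu hv huv hT ht (fun t ht _ => h0 t ht)
  have c2 : eT G v T = 0 → eT G u T = 3 := by
    intro h0
    rw [eT_zero] at h0
    rw [← h3]
    exact eT_full fun t ht => optC2 hmin h hv hu huv.symm hT ht (fun t ht _ => h0 t ht)
  refine ⟨by omega, fun h2 => ?_⟩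
  obtain ⟨a, ha, ha'⟩ := eT_one (show eT G u T = 1 by omega)
  obtain ⟨b, hb, hb'⟩ := eT_one (show eT G v T = 1 by omega)
  have := optC2 hmin h hu hv huv hT ha (fun t ht hne => by rw [ha' t ht]; exact hne)
  rw [hb' a ha] at this
  subst this
  exact ⟨a, ha, fun t ht => ⟨ha' t ht, hb' t ht⟩⟩

lemma optCount {r s c : ℕ} (hV : Fintype.card V = 3 * r + 2 * s)
    (hdeg : ∀ w, eT G w univ ≤ r + s)
    (hmin : ∀ F m c', Opt G r c' F m → c ≤ c') {F : Finset (Finset V)}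
    {m : V → V} (h : Opt G r c F m) {u v : V} (hu : u ∈ fx (WW F) m)
    (hv : v ∈ fx (WW F) m) (huv : u ≠ v) :
    (∀ T ∈ F, eT G u T + eT G v T = 2) ∧
    (∀ w ∈ WW F, ((if G.Adj u w then 1 else 0) + (if G.Adj u (m w) then 1 else 0)) +
      ((if G.Adj v w then 1 else 0) + (if G.Adj v (m w) then 1 else 0)) = 2) ∧
    eT G u univ = r + s := by
  have hW : (WW F).card = 2 * s := by
    have := card_split h.1
    rw [h.2.1] at this; omega
  have inv : ∀ f : V → ℕ, ∑ w ∈ WW F, f (m w) = ∑ w ∈ WW F, f w := by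
    intro f
    have hm := h.2.2.1
    apply Finset.sum_nbij' m m
    · exact fun w hw => (hm w hw).1
    · exact fun w hw => (hm w hw).1
    · exact fun w hw => (hm w hw).2.1
    · exact fun w hw => (hm w hw).2.1
    · intros; rfl
  have g1 : ∀ T ∈ F, 2 ≤ eT G u T + eT G v T := fun T hT => (optT2 hmin h hu hv huv hT).1
  have auv := optC0 hmin h hu hv huv
  have g2 : ∀ w ∈ WW F, 2 ≤ ((if G.Adj u w then 1 else 0) + (if G.Adj u (m w) then 1 else 0)) +
      ((if G.Adj v w then 1 else 0) + (if G.Adj v (m w) then 1 else 0)) := by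
    intro w hw
    by_cases hf : m w = w
    · by_cases e : w = u
      · subst e; rw [hf]; simp [auv.symm]
      by_cases e' : w = v
      · subst e'; rw [hf]; simp [auv]
      have := optC0 hmin h hu (mem_fx.2 ⟨hw, hf⟩) (Ne.symm e)
      have := optC0 hmin h hv (mem_fx.2 ⟨hw, hf⟩) (Ne.symm e')
      rw [hf]; simp [*]
    · have q1 := optC1 hmin h hu hv huv hw hf
      have q2 := optC1 hmin h hv hu huv.symm hw hf
      split_ifs <;> first | omega | tauto
  have s1 := Finset.sum_le_sum g1
  have s2 := Finset.sum_le_sum g2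
  have s3 := deg_split h.1 u
  have s4 := deg_split h.1 v
  have d1 := hdeg u
  have d2 := hdeg v
  have e2 : ∑ w ∈ WW F, (((if G.Adj u w then 1 else 0) + (if G.Adj u (m w) then 1 else 0)) +
      ((if G.Adj v w then 1 else 0) + (if G.Adj v (m w) then 1 else 0)))
      = 2 * eT G u (WW F) + 2 * eT G v (WW F) := by
    rw [sum_add_distrib, sum_add_distrib, sum_add_distrib,
      inv (fun w => if G.Adj u w then 1 else 0), inv (fun w => if G.Adj v w then 1 else 0),
      eT_sum, eT_sum]
    ring
  have e1 : ∑ T ∈ F, (eT G u T + eT G v T) = ∑ T ∈ F, eT G u T + ∑ T ∈ F, eT G v T :=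
    sum_add_distrib
  have k1 : ∑ T ∈ F, 2 = 2 * r := by rw [sum_const, h.2.1, smul_eq_mul, mul_comm]
  have k2 : ∑ w ∈ WW F, 2 = 4 * s := by rw [sum_const, hW, smul_eq_mul]; ring
  have t1 := (sum_eq_sum_iff_of_le g1).1 (by omega)
  have t2 := (sum_eq_sum_iff_of_le g2).1 (by omega)
  exact ⟨fun T hT => (t1 T hT).symm, fun w hw => (t2 w hw).symm, by omega⟩

lemma optTwin {r s c : ℕ} (hr : 1 ≤ r) (hV : Fintype.card V = 3 * r + 2 * s)
    (hdeg : ∀ w, eT G w univ ≤ r + s)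
    (hmin : ∀ F m c', Opt G r c' F m → c ≤ c') {F : Finset (Finset V)}
    {m : V → V} (h : Opt G r c F m) {u v : V} (hu : u ∈ fx (WW F) m)
    (hv : v ∈ fx (WW F) m) (huv : u ≠ v) :
    ∀ z, z ≠ u → z ≠ v → (G.Adj u z ↔ G.Adj v z) ∧
      (G.Adj v z → ∃ F' m', Opt G r c F' m' ∧ u ∈ fx (WW F') m' ∧ z ∈ fx (WW F') m') := by
  obtain ⟨t1, t2, -⟩ := optCount hV hdeg hmin h hu hv huv
  intro z hzu hzv
  by_cases hz : z ∈ WW F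
  · obtain ⟨T, hT⟩ := card_pos.1 (show 0 < F.card by rw [h.2.1]; omega)
    obtain ⟨a, ha, ha'⟩ := (optT2 hmin h hu hv huv hT).2 (t1 T hT)
    have za := not_mem_W hT hz ha
    have va := not_mem_W hT (mem_fx.1 hv).1 ha
    have ua := not_mem_W hT (mem_fx.1 hu).1 ha
    obtain ⟨F1, m1, b1, b2, b3, b4⟩ := optT h hu hT ha
      (fun t ht hne => by rw [(ha' t ht).1]; exact hne)
    obtain ⟨F2, m2, c1, c2, c3, c4⟩ := optT h hv hT ha
      (fun t ht hne => by rw [(ha' t ht).2]; exact hne)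
    have k0 := t2 z hz
    have k1 := (optCount hV hdeg hmin b1 (u := a) (v := v) (by rw [b3]; simp)
      (by rw [b3]; simp [huv.symm, hv]) va.symm).2.1 z (by rw [b2]; simp [hzu, hz])
    have k2 := (optCount hV hdeg hmin c1 (u := a) (v := u) (by rw [c3]; simp)
      (by rw [c3]; simp [huv, hu]) ua.symm).2.1 z (by rw [c2]; simp [hzv, hz])
    rw [b4 z za] at k1
    rw [c4 z za] at k2
    have hf : m z ≠ z := by
      intro hf
      have := optC0 hmin h hu (mem_fx.2 ⟨hz, hf⟩) hzu.symm
      have := optC0 hmin h hv (mem_fx.2 ⟨hz, hf⟩) hzv.symm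
      rw [hf] at k0
      simp [*] at k0
    have q1 := optC1 hmin h hu hv huv hz hf
    have q2 := optC1 hmin h hv hu huv.symm hz hf
    have x1 : (if G.Adj u z then 1 else 0) + (if G.Adj u (m z) then 1 else 0) = 1 := by omega
    have x2 : (if G.Adj v z then 1 else 0) + (if G.Adj v (m z) then 1 else 0) = 1 := by omega
    constructor
    · clear k0 k1 k2
      split_ifs at x1 x2 <;> first | omega | tauto
    · intro hvz
      have : ¬ G.Adj v (m z) := by
        intro h'; simp [hvz, h'] at x2
      obtain ⟨m', p1, p2⟩ := optP h hv hz hf this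
      exact ⟨F, m', p1, by rw [p2]; simp [huv, hu], by rw [p2]; simp⟩
  · rw [mem_WW] at hz
    push Not at hz
    obtain ⟨T, hT, hzT⟩ := hz
    obtain ⟨a, ha, ha'⟩ := (optT2 hmin h hu hv huv hT).2 (t1 T hT)
    refine ⟨by rw [(ha' z hzT).1, (ha' z hzT).2], fun hvz => ?_⟩
    rw [(ha' z hzT).2] at hvz
    subst hvz
    obtain ⟨F2, m2, c1, c2, c3, c4⟩ := optT h hv hT ha
      (fun t ht hne => by rw [(ha' t ht).2]; exact hne)
    exact ⟨F2, m2, c1, by rw [c3]; simp [huv, hu], by rw [c3]; simp⟩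

lemma fx_parity {W : Finset V} {m : V → V} (hm : MM G W m) (hW : Even W.card) :
    Even (fx W m).card := by
  have h0 : ∑ w ∈ W.filter (fun w => ¬ m w = w), (1 : ZMod 2) = 0 := by
    refine Finset.sum_involution (fun w _ => m w) ?_ ?_ ?_ ?_
    · intros; decide
    · intro w hw _; exact (mem_filter.1 hw).2
    · intro w hw
      rw [mem_filter] at hw ⊢
      refine ⟨(hm w hw.1).1, ?_⟩
      rw [(hm w hw.1).2.1]
      exact fun h => hw.2 h.symm
    · intro w hw
      exact (hm w (mem_filter.1 hw).1).2.1
  have h1 : Even (W.filter (fun w => ¬ m w = w)).card := by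
    rw [sum_const, nsmul_eq_mul, mul_one, ZMod.natCast_eq_zero_iff] at h0
    exact even_iff_two_dvd.2 h0
  have h2 := card_filter_add_card_filter_not (s := W) (fun w => m w = w)
  unfold fx
  rw [← h2, Nat.even_add] at hW
  exact hW.2 h1

lemma lemE {r s : ℕ} (hr : 1 ≤ r) (hV : Fintype.card V = 3 * r + 2 * s)
    (hdeg : ∀ w, eT G w univ ≤ r + s) (hcf : G.CliqueFree (r + s + 1))
    {F : Finset (Finset V)} (hF : TF G F) (hFr : F.card = r) :
    ∃ F m, Opt G r 0 F m := by
  classical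
  have hex : ∃ c, ∃ F m, Opt G r c F m :=
    ⟨_, F, id, hF, hFr, fun w hw => ⟨hw, rfl, G.irrefl⟩, rfl⟩
  obtain ⟨F, m, h⟩ := Nat.find_spec hex
  have hmin : ∀ F m c', Opt G r c' F m → Nat.find hex ≤ c' :=
    fun F m c' h => Nat.find_min' hex ⟨F, m, h⟩
  generalize Nat.find hex = c at h hmin
  rcases Nat.eq_zero_or_pos c with hc | hc
  · subst hc; exact ⟨F, m, h⟩
  exfalso
  have hW : (WW F).card = 2 * s := by
    have := card_split h.1
    rw [h.2.1] at this; omega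
  have hev := fx_parity h.2.2.1 (by rw [hW]; exact even_two_mul s)
  rw [h.2.2.2] at hev
  obtain ⟨d, hd⟩ := hev
  obtain ⟨u, hu, v, hv, huv⟩ := one_lt_card.1 (show 1 < (fx (WW F) m).card by
    rw [h.2.2.2]; omega)
  have hk := (optCount hV hdeg hmin h hu hv huv).2.2
  have tw := optTwin hr hV hdeg hmin h hu hv huv
  have tw2 : ∀ z, G.Adj u z → ∀ y, G.Adj u y → y ≠ z → G.Adj z y := by
    intro z hz y hy hyz
    have hyu := hy.ne'
    by_cases e : z = v
    · subst e
      exact (tw y hyu hyz).1.1 hy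
    · obtain ⟨t1, t2⟩ := tw z hz.ne' e
      obtain ⟨F', m', g1, g2, g3⟩ := t2 (t1.1 hz)
      exact (optTwin hr hV hdeg hmin g1 g2 g3 hz.ne y hyu hyz).1.1 hy
  refine hcf (insert u (univ.filter (G.Adj u))) ⟨?_, ?_⟩
  · intro x hx y hy hxy
    simp only [coe_insert, coe_filter, mem_univ, true_and, Set.mem_insert_iff,
      Set.mem_ofPred_eq] at hx hy
    rcases hx with rfl | hx <;> rcases hy with rfl | hy
    · exact absurd rfl hxy
    · exact hy
    · exact hx.symm
    · exact tw2 x hx y hy hxy.symm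
  · rw [card_insert_of_notMem (by simp)]
    unfold eT at hk
    rw [hk]

lemma tf_bot {r : ℕ} (hV : 3 * r ≤ Fintype.card V) :
    ∃ F : Finset (Finset V), TF (⊥ : SimpleGraph V) F ∧ F.card = r := by
  induction r with
  | zero => exact ⟨∅, ⟨by simp, by simp⟩, rfl⟩
  | succ i ih =>
    obtain ⟨F, h1, h2⟩ := ih (by omega)
    have := card_split h1
    obtain ⟨T, hT, hc⟩ := exists_subset_card_eq (show 3 ≤ (WW F).card by omega)
    obtain ⟨a1, a2, -⟩ := tf_insert h1 hc (by simp) hT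
    exact ⟨_, a1, by omega⟩

lemma mainQ {r s : ℕ} (hr : 1 ≤ r) (hs : 1 ≤ s) (hrs : 2 ≤ r ∨ 2 ≤ s)
    (hV : Fintype.card V = 3 * r + 2 * s) (H : SimpleGraph V) :
    (∀ [DecidableRel H.Adj] (w : V), eT H w univ ≤ r + s) → H.CliqueFree (r + s + 1) →
    ∃ F m, Opt H r 0 F m := by
  classical
  induction H using WellFoundedLT.induction with
  | ind H ih =>
  intro hdeg hcf
  by_cases hex : ∃ F, TF H F ∧ F.card = r
  · obtain ⟨F, h1, h2⟩ := hex
    exact lemE hr hV hdeg hcf h1 h2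
  exfalso
  push Not at hex
  have hb : H ≠ ⊥ := by
    rintro rfl
    obtain ⟨F, h1, h2⟩ := tf_bot (V := V) (r := r) (by omega)
    exact hex F h1 h2
  obtain ⟨x, y, hxy⟩ := SimpleGraph.ne_bot_iff_exists_adj.1 hb
  have hadj : ∀ a b, (H.deleteEdges {s(x, y)}).Adj a b ↔
      H.Adj a b ∧ ¬ ((a = x ∧ b = y) ∨ (a = y ∧ b = x)) := by
    intro a b; simp
  have hle : H.deleteEdges {s(x, y)} ≤ H := SimpleGraph.deleteEdges_le _
  have hlt : H.deleteEdges {s(x, y)} < H := by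
    refine lt_of_le_of_ne hle fun h => ?_
    rw [← h, hadj] at hxy
    exact hxy.2 (Or.inl ⟨rfl, rfl⟩)
  generalize H.deleteEdges {s(x, y)} = H' at hadj hle hlt
  obtain ⟨F, m, g1, g2, g3, g4⟩ := ih H' hlt (by
    intro _ w
    refine le_trans ?_ (hdeg w)
    unfold eT
    apply card_le_card
    intro t
    rw [mem_filter, mem_filter]
    exact fun h => ⟨h.1, hle h.2⟩) (SimpleGraph.CliqueFree.anti hle hcf)
  have hT : ∃ T ∈ F, x ∈ T ∧ y ∈ T := by
    by_contra hn
    push Not at hn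
    refine hex F ⟨fun T hT => ⟨(g1.1 T hT).1, fun a ha b hb hab => ?_⟩, g1.2⟩ g2
    have := (g1.1 T hT).2 a ha b hb
    rw [hadj] at this
    have := hn T hT
    grind
  obtain ⟨T, hT, hxT, hyT⟩ := hT
  obtain ⟨c3, ind⟩ := g1.1 T hT
  obtain ⟨z, hz⟩ := card_pos.1 (show 0 < ((T.erase x).erase y).card by
    rw [card_erase_of_mem (mem_erase.2 ⟨hxy.ne', hyT⟩), card_erase_of_mem hxT]; omega)
  simp only [mem_erase] at hz
  obtain ⟨hzy, hzx, hzT⟩ := hz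
  have hTe : T = {x, y, z} := by
    symm
    apply eq_of_subset_of_card_le
    · intro t; simp only [mem_insert, mem_singleton]
      rintro (rfl | rfl | rfl) <;> assumption
    · rw [c3, card_eq_three.2 ⟨x, y, z, hxy.ne, hzx.symm, hzy.symm, rfl⟩]
  obtain ⟨e1, e2, e3⟩ := tf_erase g1 hT
  have xW : x ∉ WW F := fun h => mem_WW.1 h T hT hxT
  have yW : y ∉ WW F := fun h => mem_WW.1 h T hT hyT
  have zW : z ∉ WW F := fun h => mem_WW.1 h T hT hzT
  have hF1 : TF H (F.erase T) := by
    refine ⟨fun S hS => ⟨(e1.1 S hS).1, fun a ha b hb hab => ?_⟩, e1.2⟩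
    have := (e1.1 S hS).2 a ha b hb
    rw [hadj] at this
    have hd := Finset.disjoint_left.1 (g1.2 S (mem_of_mem_erase hS) T hT (mem_erase.1 hS).1)
    grind
  have hm : MM H (WW F) m := by
    intro w hw
    obtain ⟨a1, a2, a3⟩ := g3 w hw
    refine ⟨a1, a2, fun h => ?_⟩
    rw [hadj] at a3
    grind
  have hyz : ¬ H.Adj y z := by
    intro h
    have := ind y hyT z hzT
    rw [hadj] at this
    have := hxy.ne
    grind
  obtain ⟨m1, p1, p2⟩ := addPair hm yW zW hzy.symm hyz
  obtain ⟨m2, p3, p4⟩ := addSingle p1 (p := x) (by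
    simp only [mem_insert, not_or]; exact ⟨hxy.ne, hzx.symm, xW⟩)
  have hWe : WW (F.erase T) = insert x (insert y (insert z (WW F))) := by
    rw [e3, hTe]; ext t; simp only [mem_union, mem_insert, mem_singleton]; tauto
  rw [p2, card_eq_zero.1 g4, ← hWe] at p4
  rw [← hWe] at p3
  have hcs := card_split hF1
  refine lemD hF1 ?_ (N := s + 1) (by omega) (by omega) (by omega) ?_ p3 (v := x)
    (by rw [p4]; rfl) ?_
  · intro F' h1 h2; exact hex F' h1 (by omega)
  · intro w; have := hdeg w; omega
  · have : #(F.erase T) + (s + 1) + 1 = r + s + 1 := by omega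
    rw [this]; exact hcf

lemma eqcol {k : ℕ} (P : Finset (Finset V)) (hP : P.card = k) (hu : ∀ v, ∃ A ∈ P, v ∈ A)
    (hd : ∀ A ∈ P, ∀ B ∈ P, A ≠ B → Disjoint A B)
    (hi : ∀ A ∈ P, ∀ u ∈ A, ∀ w ∈ A, ¬ G.Adj u w) (hc : ∀ A ∈ P, A.card = 2 ∨ A.card = 3) :
    EqColorable G k := by
  classical
  choose cl h1 h2 using hu
  let e := P.equivFinOfCardEq hP
  have huq : ∀ v, ∀ A ∈ P, v ∈ A → cl v = A := by
    intro v A hA hv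
    by_contra hne
    exact Finset.disjoint_left.1 (hd _ (h1 v) A hA hne) (h2 v) hv
  have fib : ∀ i, (univ.filter fun v => e ⟨cl v, h1 v⟩ = i) = (e.symm i).1 := by
    intro i
    ext v
    rw [mem_filter, ← Equiv.eq_symm_apply, Subtype.ext_iff]
    constructor
    · rintro ⟨-, h⟩; rw [← h]; exact h2 v
    · intro h; exact ⟨mem_univ _, huq v _ (e.symm i).2 h⟩
  refine ⟨fun v => e ⟨cl v, h1 v⟩, ?_, ?_⟩
  · intro u v huv h
    have : cl u = cl v := by simpa using h
    exact hi _ (h1 u) u (h2 u) v (this ▸ h2 v) huv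
  · intro i j
    rw [fib, fib]
    have := hc _ (e.symm i).2
    have := hc _ (e.symm j).2
    omega

lemma opt_eqcol {r s : ℕ} (hV : Fintype.card V = 3 * r + 2 * s) {F : Finset (Finset V)} {m : V → V}
    (h : Opt G r 0 F m) : EqColorable G (r + s) := by
  obtain ⟨h1, h2, h3, h4⟩ := h
  have h4' : ∀ w ∈ WW F, m w ≠ w := by
    intro w hw e
    have : w ∈ fx (WW F) m := mem_fx.2 ⟨hw, e⟩
    rw [card_eq_zero.1 h4] at this
    simp at this
  have hcs := card_split h1
  set P := (WW F).image (fun w => ({w, m w} : Finset V)) with hPd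
  have pc : ∀ A ∈ P, A.card = 2 := by
    intro A hA
    obtain ⟨w, hw, rfl⟩ := mem_image.1 hA
    exact card_pair (h4' w hw).symm
  have pW : ∀ A ∈ P, A ⊆ WW F := by
    intro A hA
    obtain ⟨w, hw, rfl⟩ := mem_image.1 hA
    intro t
    rw [mem_insert, mem_singleton]
    rintro (rfl | rfl)
    · exact hw
    · exact (h3 w hw).1
  have pu : ∀ A ∈ P, ∀ t ∈ A, A = {t, m t} := by
    intro A hA t ht
    obtain ⟨w, hw, rfl⟩ := mem_image.1 hA
    rw [mem_insert, mem_singleton] at ht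
    rcases ht with rfl | rfl
    · rfl
    · rw [(h3 w hw).2.1]; exact pair_comm _ _
  have pd : ∀ A ∈ P, ∀ B ∈ P, A ≠ B → Disjoint A B := by
    intro A hA B hB hne
    rw [Finset.disjoint_left]
    intro t ha hb
    exact hne ((pu A hA t ha).trans (pu B hB t hb).symm)
  have pi : ∀ A ∈ P, ∀ u ∈ A, ∀ w ∈ A, ¬ G.Adj u w := by
    intro A hA u hu w hw
    have := pu A hA u hu
    rw [this, mem_insert, mem_singleton] at hw
    rcases hw with rfl | rfl
    · exact G.irrefl
    · exact (h3 u (pW A hA hu)).2.2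
  have hbi : P.biUnion id = WW F := by
    ext t
    rw [mem_biUnion]
    constructor
    · rintro ⟨A, hA, ht⟩; exact pW A hA ht
    · intro ht; exact ⟨{t, m t}, mem_image_of_mem _ ht, by simp⟩
  have hcP : (WW F).card = P.card * 2 := by
    rw [← hbi, card_biUnion (t := id) pd]
    exact sum_const_nat pc
  have hFP : Disjoint F P := by
    rw [Finset.disjoint_left]
    intro A hA hB
    have := pc A hB
    have := (h1.1 A hA).1
    omega
  have hFP2 : ∀ A ∈ F, ∀ B ∈ P, Disjoint A B := by
    intro A hA B hB
    rw [Finset.disjoint_left]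
    intro t ha hb
    exact mem_WW.1 (pW B hB hb) A hA ha
  apply eqcol (F ∪ P)
  · rw [card_union_of_disjoint hFP]; omega
  · intro v
    by_cases hv : v ∈ WW F
    · exact ⟨{v, m v}, mem_union_right _ (mem_image_of_mem _ hv), by simp⟩
    · rw [mem_WW] at hv
      push Not at hv
      obtain ⟨T, hT, hvT⟩ := hv
      exact ⟨T, mem_union_left _ hT, hvT⟩
  · intro A hA B hB hne
    rw [mem_union] at hA hB
    rcases hA with hA | hA <;> rcases hB with hB | hB
    · exact h1.2 A hA B hB hne
    · exact hFP2 A hA B hB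
    · exact (hFP2 B hB A hA).symm
    · exact pd A hA B hB hne
  · intro A hA
    rcases mem_union.1 hA with hA | hA
    · exact (h1.1 A hA).2
    · exact pi A hA
  · intro A hA
    rcases mem_union.1 hA with hA | hA
    · exact Or.inr (h1.1 A hA).1
    · exact Or.inl (pc A hA)

lemma cliqueFree_of_comp
    (hcomp : ∀ K : G.ConnectedComponent,
      ¬ (K.supp.ncard = G.maxDegree + 1 ∧
         ∀ u ∈ K.supp, ∀ v ∈ K.supp, u ≠ v → G.Adj u v)) :
    G.CliqueFree (G.maxDegree + 1) := by
  intro S hS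
  obtain ⟨hcl, hcard⟩ := hS
  obtain ⟨x, hx⟩ := card_pos.1 (show 0 < S.card by omega)
  have clos : ∀ a ∈ S, ∀ b, G.Adj a b → b ∈ S := by
    intro a ha b hab
    have h1 : S.erase a = G.neighborFinset a := by
      apply eq_of_subset_of_card_le
      · intro t ht
        rw [mem_erase] at ht
        rw [SimpleGraph.mem_neighborFinset]
        exact hcl ha ht.2 ht.1.symm
      · rw [card_erase_of_mem ha, SimpleGraph.card_neighborFinset_eq_degree, hcard]
        exact G.degree_le_maxDegree a
    have : b ∈ G.neighborFinset a := (SimpleGraph.mem_neighborFinset _ _ _).2 hab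
    rw [← h1] at this
    exact mem_of_mem_erase this
  have wk : ∀ a b, G.Walk a b → a ∈ S → b ∈ S := by
    intro a b p
    induction p with
    | nil => exact id
    | cons h _ ih => exact fun ha => ih (clos _ ha _ h)
  have hsupp : (G.connectedComponentMk x).supp = (S : Set V) := by
    ext t
    rw [SimpleGraph.ConnectedComponent.mem_supp_iff, SimpleGraph.ConnectedComponent.eq, mem_coe]
    constructor
    · rintro ⟨p⟩; exact wk _ _ p.reverse hx
    · intro ht
      by_cases e : t = x
      · subst e; exact SimpleGraph.Reachable.refl _
      · exact (hcl ht hx e).reachable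
  refine hcomp (G.connectedComponentMk x) ?_
  rw [hsupp, Set.ncard_coe_finset]
  exact ⟨hcard, fun u hu v hv hne => hcl hu hv hne⟩

end EqHelpers2

theorem stmt2 [Fintype V] [DecidableEq V] (G : SimpleGraph V) [DecidableRel G.Adj]
    (h6 : 6 ≤ Fintype.card V)
    (hlow : Fintype.card V + 1 ≤ 3 * G.maxDegree)
    (hhigh : 2 * G.maxDegree < Fintype.card V)
    (hcomp : ∀ K : G.ConnectedComponent,
      ¬ (K.supp.ncard = G.maxDegree + 1 ∧
         ∀ u ∈ K.supp, ∀ v ∈ K.supp, u ≠ v → G.Adj u v)) :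
    EqColorable G G.maxDegree := by
  obtain ⟨r, hr⟩ : ∃ r, Fintype.card V = 2 * G.maxDegree + r :=
    ⟨Fintype.card V - 2 * G.maxDegree, by omega⟩
  obtain ⟨s, hs⟩ : ∃ s, G.maxDegree = r + s := ⟨G.maxDegree - r, by omega⟩
  have hV : Fintype.card V = 3 * r + 2 * s := by omega
  have hcf := cliqueFree_of_comp hcomp
  have hdg : ∀ w, eT G w univ ≤ G.maxDegree := by
    intro w
    refine le_trans (le_of_eq ?_) (G.degree_le_maxDegree w)
    rw [← SimpleGraph.card_neighborFinset_eq_degree, eT]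
    congr 1
    ext t; simp
  obtain ⟨F, m, h⟩ := mainQ (r := r) (s := s) (by omega) (by omega) (by omega) hV G (by
    intro inst w
    have e := hdg w
    rw [← hs]
    convert e) (by rw [← hs]; exact hcf)
  rw [hs]
  exact opt_eqcol hV h
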